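/- arXiv:2108.10589 — 7 statements merged into one kernel-verified Lean document; each statement's English description precedes it below -/
import Mathlib

section
/- Assume the Pontryagin data hold for the control b with trajectory (s,i), and moreover that p₁ = 0 and s(t_f) < γ/β. Then: (1) the Hamiltonian constant satisfies k = p₀λ₁; (2) η(t) ≥ 0 for almost every t ∈ [0, t_f]; (3) p_s is continuous, nonincreasing and nonnegative on [0, t_f]. -/
open MeasureTheory Set Real
open scoped ENNReal

noncomputable section

/-- An admissible control: a Borel-measurable function with values in `[βs, β]`. -/
def IsAdmissible (βs β : ℝ) (b : ℝ → ℝ) : Prop :=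
  Measurable b ∧ ∀ t, b t ∈ Set.Icc βs β

/-- `(s, i)` is the trajectory of the controlled SIR system `s' = -b s i`,
`i' = b s i - γ i` issued from `(s₀, i₀)`, in integral (Carathéodory) form. -/
def IsTrajectory (γ : ℝ) (b : ℝ → ℝ) (s₀ i₀ : ℝ) (s i : ℝ → ℝ) : Prop :=
  Continuous s ∧ Continuous i ∧
    (∀ t : ℝ, s t = s₀ - ∫ r in (0:ℝ)..t, b r * s r * i r) ∧
    (∀ t : ℝ, i t = i₀ + ∫ r in (0:ℝ)..t, (b r * s r - γ) * i r)

/-- Membership in the triangle `𝕋 = {(s,i) : s ≥ 0, i ≥ 0, s + i ≤ 1}`. -/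
def MemT (s i : ℝ) : Prop := 0 ≤ s ∧ 0 ≤ i ∧ s + i ≤ 1

/-- The boundary functions `Φ_A` (with `βx = β`, `sM = s_M`) and `Φ_B`
(with `βx = β_*`, `sM = s_M^*`). -/
def Phi (γ βx iM sM : ℝ) (s : ℝ) : ℝ :=
  if s ≤ γ / βx then iM
  else if s < sM then iM - s + γ / βx + (γ / βx) * Real.log (βx * s / γ)
  else 0

/-- The cost functional `J(t_f, b) = ∫₀^{t_f} (λ₁ + λ₂ (β - b(t))) dt`. -/
def cost (β lam1 lam2 tf : ℝ) (b : ℝ → ℝ) : ℝ :=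
  ∫ t in (0:ℝ)..tf, (lam1 + lam2 * (β - b t))

/-- Pontryagin data for the control `b` with trajectory `(s, i)` on `[0, tf]`:
multipliers `p0, p1 ≥ 0`, a finite nonnegative Borel measure `μ` supported in
`[0, tf]` with the complementarity condition, right-continuous BV adjoint states
`ps, pi` solving the integrated adjoint equations (with `η = pi - ps`), the
minimality condition, and the conservation of the Hamiltonian with constant `k`. -/
structure PontryaginData (γ βs β iM tf lam1 lam2 : ℝ) (b s i : ℝ → ℝ) where
  p0 : ℝ
  p1 : ℝ
  k : ℝ
  μ : Measure ℝ
  ps : ℝ → ℝ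
  pii : ℝ → ℝ
  p0_nonneg : 0 ≤ p0
  p1_nonneg : 0 ≤ p1
  μ_fin : IsFiniteMeasure μ
  μ_supp : μ (Set.Icc (0:ℝ) tf)ᶜ = 0
  complementarity : ∫ t, (i t - iM) ∂μ = 0
  ps_bv : BoundedVariationOn ps (Set.Icc 0 tf)
  pi_bv : BoundedVariationOn pii (Set.Icc 0 tf)
  ps_rc : ∀ t ∈ Set.Icc (0:ℝ) tf, ContinuousWithinAt ps (Set.Ici t) t
  pi_rc : ∀ t ∈ Set.Icc (0:ℝ) tf, ContinuousWithinAt pii (Set.Ici t) t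
  adjoint_s : ∀ t ∈ Set.Icc (0:ℝ) tf,
    ps t = p1 + ∫ r in t..tf, (pii r - ps r) * b r * i r
  adjoint_i : ∀ t ∈ Set.Icc (0:ℝ) tf,
    pii t = (∫ r in t..tf, ((pii r - ps r) * b r * s r - γ * pii r)) +
      (μ (Set.Ioc t tf)).toReal
  minimality : ∀ᵐ t ∂(volume.restrict (Set.Icc (0:ℝ) tf)),
    ∀ b' ∈ Set.Icc βs β,
      p0 * lam2 * (β - b t) + (pii t - ps t) * b t * s t * i t ≤
        p0 * lam2 * (β - b') + (pii t - ps t) * b' * s t * i t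
  conservation : ∀ᵐ t ∂(volume.restrict (Set.Icc (0:ℝ) tf)),
    p0 * (lam1 + lam2 * (β - b t)) + (pii t - ps t) * b t * s t * i t -
      γ * pii t * i t = k

theorem aux_bv_ii {f : ℝ → ℝ} {T : ℝ} (hT : 0 ≤ T) (h : BoundedVariationOn f (Set.Icc 0 T)) :
    IntervalIntegrable f volume 0 T := by
  obtain ⟨p, q, hp, hq, rfl⟩ := h.locallyBoundedVariationOn.exists_monotoneOn_sub_monotoneOn
  rw [← uIcc_of_le hT] at hp hq
  exact hp.intervalIntegrable.sub hq.intervalIntegrable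

theorem aux_mul_b {f b : ℝ → ℝ} {βs β x y : ℝ} (hβs : 0 < βs) (hb : IsAdmissible βs β b)
    (hf : IntervalIntegrable f volume x y) :
    IntervalIntegrable (fun r => f r * b r) volume x y := by
  have hbd : ∀ r, ‖b r‖ ≤ β := fun r => by
    rw [Real.norm_eq_abs, abs_of_nonneg (hβs.le.trans (hb.2 r).1)]
    exact (hb.2 r).2
  exact ⟨hf.1.mul_bdd hb.1.aestronglyMeasurable (Filter.Eventually.of_forall hbd),
    hf.2.mul_bdd hb.1.aestronglyMeasurable (Filter.Eventually.of_forall hbd)⟩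

theorem aux_sub {f : ℝ → ℝ} {T x y : ℝ} (hf : IntervalIntegrable f volume 0 T)
    (hx : x ∈ Set.Icc 0 T) (hy : y ∈ Set.Icc 0 T) : IntervalIntegrable f volume x y := by
  apply hf.mono_set
  rw [uIcc_of_le (hx.1.trans hx.2)]
  exact uIcc_subset_Icc hx hy

theorem aux_cont {f : ℝ → ℝ} {T : ℝ} (hT : 0 ≤ T) (hf : IntervalIntegrable f volume 0 T) :
    ContinuousOn (fun t => ∫ r in t..T, f r) (Set.Icc 0 T) := by
  have h1 : ContinuousOn (fun t => ∫ r in (0:ℝ)..t, f r) (Set.Icc 0 T) := by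
    have := intervalIntegral.continuousOn_primitive_interval' hf
      (by rw [uIcc_of_le hT]; exact ⟨le_rfl, hT⟩)
    rwa [uIcc_of_le hT] at this
  have h2 : ContinuousOn (fun t => (∫ r in (0:ℝ)..T, f r) - ∫ r in (0:ℝ)..t, f r)
    (Set.Icc 0 T) := continuousOn_const.sub h1
  refine h2.congr fun t ht => ?_
  have := intervalIntegral.integral_add_adjacent_intervals
    (aux_sub hf ⟨le_rfl, hT⟩ ht) (aux_sub hf ht ⟨hT, le_rfl⟩)
  simp only
  linarith

/-- if `p₁ = 0` and `s(tf) < γ/β`, then (1) `k = p₀ λ₁`;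
(2) `η ≥ 0` a.e. on `[0, tf]`; (3) `p_s` is continuous, nonincreasing and
nonnegative on `[0, tf]`. -/
theorem stmt11 (γ βs β iM tf lam1 lam2 : ℝ)
    (hγ : 0 < γ) (hβs : 0 < βs) (hβ : βs < β) (hiM : 0 < iM) (hiM1 : iM < 1)
    (htf : 0 < tf) (hl1 : 0 ≤ lam1) (hl2 : 0 ≤ lam2)
    (b s i : ℝ → ℝ) (hb : IsAdmissible βs β b)
    (htraj : IsTrajectory γ b (s 0) (i 0) s i)
    (hpos : ∀ t ∈ Set.Icc (0:ℝ) tf, 0 < s t ∧ 0 < i t ∧ i t ≤ iM)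
    (P : PontryaginData γ βs β iM tf lam1 lam2 b s i)
    (hp1 : P.p1 = 0) (hsf : s tf < γ / β) :
    P.k = P.p0 * lam1 ∧
    (∀ᵐ t ∂(volume.restrict (Set.Icc (0:ℝ) tf)), 0 ≤ P.pii t - P.ps t) ∧
    ContinuousOn P.ps (Set.Icc 0 tf) ∧
    AntitoneOn P.ps (Set.Icc 0 tf) ∧
    ∀ t ∈ Set.Icc (0:ℝ) tf, 0 ≤ P.ps t := by
  obtain ⟨hsc, hic, hs, hi⟩ := htraj
  have htf0 := htf.le
  have hfin := P.μ_fin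
  have hps := aux_bv_ii htf0 P.ps_bv
  have hpi := aux_bv_ii htf0 P.pi_bv
  have hη : IntervalIntegrable (fun r => (P.pii r - P.ps r) * b r) volume 0 tf :=
    aux_mul_b hβs hb (hpi.sub hps)
  have hηi : IntervalIntegrable (fun r => (P.pii r - P.ps r) * b r * i r) volume 0 tf :=
    hη.mul_continuousOn hic.continuousOn
  have hηs : IntervalIntegrable (fun r => (P.pii r - P.ps r) * b r * s r) volume 0 tf :=
    hη.mul_continuousOn hsc.continuousOn
  have hF : IntervalIntegrable (fun r => (P.pii r - P.ps r) * b r * s r - γ * P.pii r)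
    volume 0 tf := hηs.sub (hpi.const_mul γ)
  have hβ0 : 0 < β := hβs.trans hβ
  have hTmem : tf ∈ Set.Icc (0:ℝ) tf := ⟨htf0, le_rfl⟩
  have hpsT : P.ps tf = 0 := by rw [P.adjoint_s tf hTmem, hp1]; simp
  have hpiT : P.pii tf = 0 := by rw [P.adjoint_i tf hTmem]; simp
  have hmin := (ae_restrict_iff' measurableSet_Icc).1 P.minimality
  have hcon := (ae_restrict_iff' measurableSet_Icc).1 P.conservation
  have hpsc : ContinuousOn P.ps (Set.Icc 0 tf) := by
    refine (aux_cont htf0 hηi).congr fun t ht => ?_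
    rw [P.adjoint_s t ht, hp1, zero_add]
  -- a point after which `β s < γ`
  obtain ⟨t1, ht10, ht1f, ht1⟩ : ∃ t1, 0 ≤ t1 ∧ t1 < tf ∧ ∀ t ∈ Set.Icc t1 tf, β * s t < γ := by
    have h0 : s tf * β < γ := by rwa [lt_div_iff₀ hβ0] at hsf
    have hev : ∀ᶠ t in nhds tf, s t * β < γ :=
      (hsc.mul continuous_const).continuousAt.eventually_lt continuousAt_const h0
    obtain ⟨ε, hε, h⟩ := Metric.eventually_nhds_iff.1 hev
    refine ⟨max 0 (tf - ε / 2), le_max_left _ _, max_lt htf (by linarith), fun t ht => ?_⟩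
    have h3 : tf - ε / 2 ≤ t := (le_max_right _ _).trans ht.1
    have := h (y := t) (by rw [Real.dist_eq, abs_lt]; constructor <;> linarith [ht.2])
    linarith
  have hilt : ∀ t ∈ Set.Ioc t1 tf, i t < iM := by
    intro t ht
    have hii : ∀ x y, IntervalIntegrable (fun r => (b r * s r - γ) * i r) volume x y := by
      intro x y
      have h1 := aux_mul_b hβs hb (hsc.intervalIntegrable (μ := volume) x y)
      have h2 := (h1.sub (intervalIntegrable_const (c := γ))).mul_continuousOn hic.continuousOn
      refine h2.congr (fun r _ => ?_)
      ring
    have h1 := intervalIntegral.intervalIntegral_pos_of_pos_on (hii t1 t).neg (fun r hr => by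
      have hr' : r ∈ Set.Icc t1 tf := ⟨hr.1.le, hr.2.le.trans ht.2⟩
      have hp := hpos r ⟨ht10.trans hr'.1, hr'.2⟩
      have : b r * s r ≤ β * s r := mul_le_mul_of_nonneg_right (hb.2 r).2 hp.1.le
      have := ht1 r hr'
      simp only [Pi.neg_apply]
      nlinarith [hp.2.1]) ht.1
    have h2 := intervalIntegral.integral_add_adjacent_intervals (hii 0 t1) (hii t1 t)
    have h3 := hi t
    have h4 := hi t1
    have h5 := (hpos t1 ⟨ht10, ht1f.le⟩).2.2
    simp only [Pi.neg_apply, intervalIntegral.integral_neg] at h1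
    linarith
  have hμsupp : ∀ᵐ t ∂P.μ, t ∈ Set.Icc (0:ℝ) tf := by
    rw [ae_iff]; exact P.μ_supp
  have hμ0 : P.μ (Set.Ioc t1 tf) = 0 := by
    have hint : Integrable (fun t => iM - i t) P.μ := by
      refine Integrable.of_bound (C := iM)
        (continuous_const.sub hic).aestronglyMeasurable ?_
      filter_upwards [hμsupp] with t ht
      have := hpos t ht
      rw [Real.norm_eq_abs, abs_le]
      constructor <;> linarith [this.2.1, this.2.2]
    have h0 : ∫ t, (iM - i t) ∂P.μ = 0 := by
      have := P.complementarity
      rw [← neg_eq_zero, ← integral_neg] at this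
      simpa using this
    have hz := (integral_eq_zero_iff_of_nonneg_ae (by
      filter_upwards [hμsupp] with t ht
      have := hpos t ht
      simp only [Pi.zero_apply]
      linarith [this.2.2]) hint).1 h0
    have : ∀ᵐ t ∂P.μ, t ∉ Set.Ioc t1 tf := by
      filter_upwards [hz] with t ht h
      have := hilt t h
      simp only [Pi.zero_apply] at ht
      linarith
    rw [ae_iff] at this
    simp only [not_not] at this
    exact this
  -- (1)
  have hk : P.k = P.p0 * lam1 := by
    let G : ℝ → ℝ := fun t => ∫ r in t..tf, ((P.pii r - P.ps r) * b r * s r - γ * P.pii r)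
    have hG : ContinuousOn G (Set.Icc 0 tf) := aux_cont htf0 hF
    have hpiG : ∀ t ∈ Set.Icc t1 tf, P.pii t = G t := by
      intro t ht
      rw [P.adjoint_i t ⟨ht10.trans ht.1, ht.2⟩,
        measure_mono_null (Set.Ioc_subset_Ioc_left ht.1) hμ0]
      simp [G]
    have hR : ContinuousWithinAt (fun t => β * |G t - P.ps t| * s t * i t + γ * |G t| * i t)
        (Set.Icc 0 tf) tf := by
      have h1 := hG tf hTmem
      have h2 := hpsc tf hTmem
      exact (((continuousWithinAt_const.mul (h1.sub h2).abs).mul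
        hsc.continuousAt.continuousWithinAt).mul hic.continuousAt.continuousWithinAt).add
        ((continuousWithinAt_const.mul h1.abs).mul hic.continuousAt.continuousWithinAt)
    by_contra hne
    have hd : 0 < |P.k - P.p0 * lam1| := abs_pos.2 (sub_ne_zero.2 hne)
    have hGT : G tf = 0 := by simp [G]
    have hev := hR.eventually_lt (continuousWithinAt_const (b := |P.k - P.p0 * lam1|))
      (by simpa [hGT, hpsT] using hd)
    rw [eventually_nhdsWithin_iff] at hev
    obtain ⟨ε, hε, h⟩ := Metric.eventually_nhds_iff.1 hev
    have hpm : volume (Set.Ioo (max t1 (tf - ε)) tf) ≠ 0 := by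
      rw [Real.volume_Ioo]
      simp only [ne_eq, ENNReal.ofReal_eq_zero, not_le, sub_pos]
      exact max_lt ht1f (by linarith)
    have hfr : ∃ t ∈ Set.Ioo (max t1 (tf - ε)) tf, (t ∈ Set.Icc (0:ℝ) tf → ∀ b' ∈ Set.Icc βs β,
      P.p0 * lam2 * (β - b t) + (P.pii t - P.ps t) * b t * s t * i t ≤
        P.p0 * lam2 * (β - b') + (P.pii t - P.ps t) * b' * s t * i t) ∧
        (t ∈ Set.Icc (0:ℝ) tf → P.p0 * (lam1 + lam2 * (β - b t)) +
          (P.pii t - P.ps t) * b t * s t * i t - γ * P.pii t * i t = P.k) := by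
      by_contra hcontra
      push Not at hcontra
      apply hpm
      refine measure_mono_null (fun t ht => ?_) (ae_iff.1 (hmin.and hcon))
      intro hh
      exact (hcontra t ht hh.1).2 (hh.2 (hcontra t ht hh.1).1)
    obtain ⟨t, ht, hm, hc⟩ := hfr
    have htt1 : t1 < t := (le_max_left _ _).trans_lt ht.1
    have htε : tf - ε < t := (le_max_right _ _).trans_lt ht.1
    have htm : t ∈ Set.Icc (0:ℝ) tf := ⟨ht10.trans htt1.le, ht.2.le⟩
    have h5 := h (y := t) (by rw [Real.dist_eq, abs_lt]; constructor <;> linarith [ht.2]) htm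
    rw [← hpiG t ⟨htt1.le, ht.2.le⟩] at h5
    have hm' := hm htm β ⟨hβ.le, le_rfl⟩
    have hc' := hc htm
    obtain ⟨hsp, hip, -⟩ := hpos t htm
    have hbt := hb.2 t
    set η := P.pii t - P.ps t
    have hsi : 0 < s t * i t := mul_pos hsp hip
    have e1 : |η * b t * s t * i t| ≤ β * |η| * s t * i t := by
      rw [mul_assoc, abs_mul, abs_of_pos hsi, abs_mul, abs_of_nonneg (hβs.le.trans hbt.1),
        mul_assoc (β * |η|), mul_comm |η|]
      exact mul_le_mul_of_nonneg_right (mul_le_mul_of_nonneg_right hbt.2 (abs_nonneg _)) hsi.le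
    have e2 : η * β * s t * i t ≤ β * |η| * s t * i t := by
      rw [mul_assoc, mul_assoc (β * |η|), mul_comm η]
      exact mul_le_mul_of_nonneg_right (mul_le_mul_of_nonneg_left (le_abs_self _) hβ0.le) hsi.le
    have e3 : |γ * P.pii t * i t| = γ * |P.pii t| * i t := by
      rw [abs_mul, abs_mul, abs_of_pos hγ, abs_of_pos hip]
    have e4 : 0 ≤ P.p0 * lam2 * (β - b t) :=
      mul_nonneg (mul_nonneg P.p0_nonneg hl2) (by linarith [hbt.2])
    have e5 : P.k - P.p0 * lam1 = P.p0 * lam2 * (β - b t) + η * b t * s t * i t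
      - γ * P.pii t * i t := by rw [← hc']; ring
    have e6 := abs_le.1 e1
    have e7 := abs_le.1 e3.le
    have : |P.k - P.p0 * lam1| ≤ β * |η| * s t * i t + γ * |P.pii t| * i t := by
      rw [e5, abs_le]
      constructor <;> linarith [e6.1, e6.2, e7.1, e7.2]
    linarith
  -- (2), at every point
  have hη0 : ∀ t ∈ Set.Icc (0:ℝ) tf, 0 ≤ P.pii t - P.ps t := by
    intro t0 ht0
    by_contra! hneg
    have hrc : ∀ t ∈ Set.Icc (0:ℝ) tf, ContinuousWithinAt (fun t => P.pii t - P.ps t)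
      (Set.Ici t) t := fun t ht => (P.pi_rc t ht).sub (P.ps_rc t ht)
    set c := P.pii t0 - P.ps t0 with hc
    let S : Set ℝ := {t | t ∈ Set.Icc t0 tf ∧ c / 2 < P.pii t - P.ps t}
    have hST : tf ∈ S := ⟨⟨ht0.2, le_rfl⟩, by rw [hpsT, hpiT]; linarith⟩
    have hSb : BddBelow S := ⟨t0, fun t ht => ht.1.1⟩
    set τ := sInf S with hτ
    have hτ1 : t0 ≤ τ := le_csInf ⟨_, hST⟩ fun t ht => ht.1.1
    have hτ2 : τ ≤ tf := csInf_le hSb hST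
    have hτm : τ ∈ Set.Icc (0:ℝ) tf := ⟨ht0.1.trans hτ1, hτ2⟩
    have hbefore : ∀ t ∈ Set.Ico t0 τ, P.pii t - P.ps t ≤ c / 2 := by
      intro t ht
      by_contra! h
      exact absurd (csInf_le hSb (show t ∈ S from ⟨⟨ht.1, ht.2.le.trans hτ2⟩, h⟩)) (not_le.2 ht.2)
    have hητ : P.pii τ - P.ps τ ≤ c := by
      have a1 := P.adjoint_s t0 ht0
      have a2 := P.adjoint_s τ hτm
      have a3 := P.adjoint_i t0 ht0
      have a4 := P.adjoint_i τ hτm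
      have a5 := intervalIntegral.integral_add_adjacent_intervals
        (aux_sub hηi ht0 hτm) (aux_sub hηi hτm hTmem)
      have a6 := intervalIntegral.integral_add_adjacent_intervals
        (aux_sub hF ht0 hτm) (aux_sub hF hτm hTmem)
      have a7 : (P.μ (Set.Ioc τ tf)).toReal ≤ (P.μ (Set.Ioc t0 tf)).toReal :=
        ENNReal.toReal_mono (measure_ne_top _ _) (measure_mono (Set.Ioc_subset_Ioc_left hτ1))
      have a8 : 0 ≤ ∫ r in t0..τ, (((P.pii r - P.ps r) * b r * s r - γ * P.pii r) -
          (P.pii r - P.ps r) * b r * i r) := by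
        apply intervalIntegral.integral_nonneg_of_ae_restrict hτ1
        change ∀ᵐ r ∂_, _
        rw [ae_restrict_iff' measurableSet_Icc]
        have hne : ∀ᵐ r : ℝ, r ≠ τ := by simp [ae_iff]
        filter_upwards [hmin, hcon, hne] with r hm hcn hr hr0
        have hrm : r ∈ Set.Icc (0:ℝ) tf := ⟨ht0.1.trans hr0.1, hr0.2.trans hτ2⟩
        have hηr := hbefore r ⟨hr0.1, lt_of_le_of_ne hr0.2 hr⟩
        have hm' := hm hrm β ⟨hβ.le, le_rfl⟩
        have hc' := hcn hrm
        rw [hk] at hc'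
        obtain ⟨hsp, hip, -⟩ := hpos r hrm
        have hbt := hb.2 r
        have hηn : P.pii r - P.ps r < 0 := by linarith
        simp only [Pi.zero_apply]
        set η := P.pii r - P.ps r
        have hsi : 0 < s r * i r := mul_pos hsp hip
        have hpp : 0 ≤ P.p0 * lam2 := mul_nonneg P.p0_nonneg hl2
        have hψ : 0 < -(η * (s r * i r)) := by
          have := mul_pos (neg_pos.2 hηn) hsi
          linarith
        have hbe : b r = β := by
          by_contra hbne
          have hlt : 0 < β - b r := sub_pos.2 (lt_of_le_of_ne hbt.2 hbne)
          have g1 := mul_pos hlt hψ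
          have g2 := mul_nonneg hpp hlt.le
          nlinarith
        rw [hbe] at hc' ⊢
        have hg : (η * β * s r - γ * P.pii r) * i r = 0 := by linarith
        have hg' : η * β * s r - γ * P.pii r = 0 :=
          (mul_eq_zero.1 hg).resolve_right hip.ne'
        rw [hg']
        have := mul_pos (mul_pos (neg_pos.2 hηn) hβ0) hip
        linarith
      rw [intervalIntegral.integral_sub (aux_sub hF ht0 hτm) (aux_sub hηi ht0 hτm)] at a8
      rw [hc]
      linarith
    rcases hτ2.eq_or_lt with h | h
    · rw [h, hpsT, hpiT] at hητ
      linarith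
    · have hev := (hrc τ hτm).eventually_lt (continuousWithinAt_const (b := c / 2))
        (by linarith)
      rw [eventually_nhdsWithin_iff] at hev
      obtain ⟨ε, hε, hh⟩ := Metric.eventually_nhds_iff.1 hev
      obtain ⟨t, htS, htlt⟩ := exists_lt_of_csInf_lt ⟨_, hST⟩ (show sInf S < τ + ε by linarith)
      have htge : τ ≤ t := csInf_le hSb htS
      have := hh (y := t) (by rw [Real.dist_eq, abs_lt]; constructor <;> linarith) htge
      exact absurd htS.2 (not_lt.2 this.le)
  have hanti : AntitoneOn P.ps (Set.Icc 0 tf) := by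
    intro x hx y hy hxy
    rw [P.adjoint_s x hx, P.adjoint_s y hy, ← intervalIntegral.integral_add_adjacent_intervals
        (aux_sub hηi hx hy) (aux_sub hηi hy hTmem)]
    have : 0 ≤ ∫ r in x..y, (P.pii r - P.ps r) * b r * i r :=
      intervalIntegral.integral_nonneg hxy fun r hr => by
        have hrm : r ∈ Set.Icc (0:ℝ) tf := ⟨hx.1.trans hr.1, hr.2.trans hy.2⟩
        exact mul_nonneg (mul_nonneg (hη0 r hrm) (hβs.le.trans (hb.2 r).1)) (hpos r hrm).2.1.le
    linarith
  refine ⟨hk, ?_, hpsc, hanti, fun t ht => ?_⟩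
  · rw [ae_restrict_iff' measurableSet_Icc]
    exact Filter.Eventually.of_forall hη0
  · have := hanti ht hTmem ht.2
    rwa [hpsT] at this
end
end

section
/- Assume the Pontryagin data hold for the control b with trajectory (s,i). Then the switching function ψ = η·s·i (right-continuous representative) satisfies, for all 0 ≤ t₁ ≤ t₂ ≤ t_f, the integral identity ψ(t₂) − ψ(t₁) = ∫_{t₁}^{t₂} γ s(r) i(r) p_s(r) dr − ∫_{(t₁, t₂]} s(r) i(r) dμ(r); that is, the distributional derivative of ψ is the measure dψ = s i γ p_s dt − s i dμ. -/
open MeasureTheory Set Real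
open scoped ENNReal

noncomputable section

lemma aux_prod (μ : Measure ℝ) [SFinite μ] (a c : ℝ) (hac : a ≤ c) (f g U V : ℝ → ℝ)
    (hf : IntegrableOn f (Ioc a c)) (hg : IntegrableOn g (Ioc a c) μ)
    (hU : ∀ t ∈ Icc a c, U t = U a + ∫ x in Ioc a t, f x)
    (hV : ∀ t ∈ Icc a c, V t = V a + ∫ x in Ioc a t, g x ∂μ) :
    IntegrableOn (fun x => f x * V x) (Ioc a c) ∧
    U c * V c - U a * V a = (∫ x in Ioc a c, f x * V x) + ∫ x in Ioc a c, U x * g x ∂μ := by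
  have hc : c ∈ Icc a c := ⟨hac, le_rfl⟩
  have hcount : Set.Countable {x : ℝ | 0 < μ {x}} :=
    Measure.countable_meas_pos_of_disjoint_iUnion (fun i => measurableSet_singleton i)
      (fun i j hij => by simpa using hij)
  have hnull : ∀ᵐ x ∂(volume.restrict (Ioc a c)), μ {x} = 0 := by
    apply ae_restrict_of_ae
    have := hcount.ae_notMem volume
    filter_upwards [this] with x hx
    simpa using hx
  let K : ℝ → ℝ → ℝ := fun x r => {p : ℝ × ℝ | p.1 ≤ p.2}.indicator (fun p => f p.1 * g p.2) (x, r)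
  have hK : Integrable (Function.uncurry K) ((volume.restrict (Ioc a c)).prod (μ.restrict (Ioc a c))) := by
    have h := Integrable.mul_prod hf hg
    exact h.indicator (measurableSet_le measurable_fst measurable_snd)
  have hswap := integral_integral_swap hK
  have hint := hK.integral_prod_left
  have hL : ∀ᵐ x ∂(volume.restrict (Ioc a c)),
      (∫ r in Ioc a c, K x r ∂μ) = f x * (V c - V x) := by
    filter_upwards [hnull, ae_restrict_mem measurableSet_Ioc] with x hx hxm
    have hxI : x ∈ Icc a c := Ioc_subset_Icc_self hxm
    have h1 : (fun r => K x r) = (Ici x).indicator (fun r => f x * g r) := by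
      ext r; simp [K, indicator]
    rw [h1, setIntegral_indicator measurableSet_Ici]
    have h2 : Ioc a c ∩ Ici x = Icc x c := by
      ext r; simp only [mem_inter_iff, mem_Ioc, mem_Ici, mem_Icc]
      constructor
      · rintro ⟨⟨_, h⟩, h'⟩; exact ⟨h', h⟩
      · rintro ⟨h', h⟩; exact ⟨⟨hxm.1.trans_le h', h⟩, h'⟩
    have h3 : (Icc x c : Set ℝ) =ᵐ[μ] Ioc x c := by
      refine Filter.EventuallyLE.antisymm ?_ Ioc_subset_Icc_self.eventuallyLE
      refine ae_le_set.2 (measure_mono_null ?_ hx)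
      intro y hy
      simp only [mem_sdiff, mem_Icc, mem_Ioc, not_and, not_le] at hy
      by_contra hne
      have : x < y := lt_of_le_of_ne hy.1.1 (fun h => hne (by simp [h]))
      linarith [hy.2 this, hy.1.2]
    rw [h2, setIntegral_congr_set h3, integral_const_mul, hV c hc, hV x hxI]
    have h4 : Ioc a c = Ioc a x ∪ Ioc x c := (Ioc_union_Ioc_eq_Ioc hxm.1.le hxm.2).symm
    rw [h4, setIntegral_union (by
      rw [Set.disjoint_left]; intro y h h'; exact absurd h.2 (not_le.2 h'.1)) measurableSet_Ioc
      (hg.mono_set (Ioc_subset_Ioc_right hxm.2)) (hg.mono_set (Ioc_subset_Ioc_left hxm.1.le))]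
    ring
  have hR : ∀ r ∈ Ioc a c, (∫ x in Ioc a c, K x r) = (U r - U a) * g r := by
    intro r hr
    have h1 : (fun x => K x r) = (Iic r).indicator (fun x => f x * g r) := by
      ext x; simp [K, indicator]
    rw [h1, setIntegral_indicator measurableSet_Iic, integral_mul_const, hU r (Ioc_subset_Icc_self hr)]
    have h2 : Ioc a c ∩ Iic r = Ioc a r := by
      ext x; simp only [mem_inter_iff, mem_Ioc, mem_Iic]
      constructor
      · rintro ⟨⟨h, _⟩, h'⟩; exact ⟨h, h'⟩
      · rintro ⟨h, h'⟩; exact ⟨⟨h, h'.trans hr.2⟩, h'⟩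
    rw [h2]; ring
  have hI : IntegrableOn (fun x => f x * (V c - V x)) (Ioc a c) := hint.congr hL
  have hIV : IntegrableOn (fun x => f x * V x) (Ioc a c) := by
    have : IntegrableOn (fun x => f x * V c - f x * (V c - V x)) (Ioc a c) :=
      Integrable.sub (hf.mul_const _) hI
    refine this.congr (Filter.Eventually.of_forall fun x => ?_)
    ring
  have hIR : IntegrableOn (fun r => (U r - U a) * g r) (Ioc a c) μ := by
    refine hK.integral_prod_right.congr ?_
    filter_upwards [ae_restrict_mem measurableSet_Ioc] with r hr
    exact hR r hr
  refine ⟨hIV, ?_⟩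
  rw [integral_congr_ae hL, setIntegral_congr_fun measurableSet_Ioc hR] at hswap
  have e1 : (∫ x in Ioc a c, f x * (V c - V x)) =
      (∫ x in Ioc a c, f x) * V c - ∫ x in Ioc a c, f x * V x := by
    rw [← integral_mul_const, ← integral_sub (hf.mul_const _) hIV]
    congr 1; ext x; ring
  have e2 : (∫ x in Ioc a c, U x * g x ∂μ) =
      (∫ r in Ioc a c, (U r - U a) * g r ∂μ) + U a * ∫ r in Ioc a c, g r ∂μ := by
    rw [← integral_const_mul, ← integral_add hIR (hg.const_mul _)]
    congr 1; ext x; ring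
  rw [e2, ← hswap, e1]
  have u := hU c hc
  have v := hV c hc
  rw [u, v]; ring

lemma aux_bv (p : ℝ → ℝ) (a c : ℝ) (h : BoundedVariationOn p (Icc a c)) :
    IntegrableOn p (Icc a c) := by
  obtain ⟨q, r, hq, hr, e⟩ := h.locallyBoundedVariationOn.exists_monotoneOn_sub_monotoneOn
  rw [e]
  exact (hq.integrableOn_isCompact isCompact_Icc).sub (hr.integrableOn_isCompact isCompact_Icc)

lemma aux_cont_s12 (p q : ℝ → ℝ) (a c : ℝ) (h : IntegrableOn p (Icc a c)) (hq : Continuous q) :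
    IntegrableOn (fun x => p x * q x) (Icc a c) :=
  h.mul_continuousOn hq.continuousOn isCompact_Icc

lemma aux_b (p b : ℝ → ℝ) (βs β a c : ℝ) (h : IntegrableOn p (Icc a c))
    (hb : IsAdmissible βs β b) :
    IntegrableOn (fun x => p x * b x) (Icc a c) := by
  refine Integrable.mul_bdd (c := max |βs| |β|) h hb.1.aestronglyMeasurable
    (Filter.Eventually.of_forall fun x => ?_)
  exact abs_le_max_abs_abs (hb.2 x).1 (hb.2 x).2

/-- the switching function `ψ = η s i` satisfies, for all
`0 ≤ t₁ ≤ t₂ ≤ tf`,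
`ψ(t₂) − ψ(t₁) = ∫_{t₁}^{t₂} γ s i p_s dr − ∫_{(t₁,t₂]} s i dμ`,
i.e. its distributional derivative is `dψ = s i γ p_s dt − s i dμ`. -/
theorem stmt12 (γ βs β iM tf lam1 lam2 : ℝ)
    (hγ : 0 < γ) (hβs : 0 < βs) (hβ : βs < β) (hiM : 0 < iM) (hiM1 : iM < 1)
    (htf : 0 < tf) (hl1 : 0 ≤ lam1) (hl2 : 0 ≤ lam2)
    (b s i : ℝ → ℝ) (hb : IsAdmissible βs β b)
    (htraj : IsTrajectory γ b (s 0) (i 0) s i)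
    (hpos : ∀ t ∈ Set.Icc (0:ℝ) tf, 0 < s t ∧ 0 < i t ∧ i t ≤ iM)
    (P : PontryaginData γ βs β iM tf lam1 lam2 b s i) :
    ∀ t₁ t₂ : ℝ, 0 ≤ t₁ → t₁ ≤ t₂ → t₂ ≤ tf →
      (P.pii t₂ - P.ps t₂) * s t₂ * i t₂ - (P.pii t₁ - P.ps t₁) * s t₁ * i t₁ =
        (∫ r in t₁..t₂, γ * s r * i r * P.ps r) -
          ∫ r in Set.Ioc t₁ t₂, s r * i r ∂P.μ := by
  intro t₁ t₂ h1 h12 h2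
  have := P.μ_fin
  obtain ⟨hsc, hic, hs, hi⟩ := htraj
  have hps : IntegrableOn P.ps (Icc 0 tf) := aux_bv _ _ _ P.ps_bv
  have hpi : IntegrableOn P.pii (Icc 0 tf) := aux_bv _ _ _ P.pi_bv
  have hone : IntegrableOn (fun _ : ℝ => (1:ℝ)) (Icc 0 tf) := continuous_const.integrableOn_Icc
  have hbI : IntegrableOn b (Icc 0 tf) := by simpa using aux_b _ b βs β _ _ hone hb
  have hη : IntegrableOn (fun r => (P.pii r - P.ps r) * b r) (Icc 0 tf) :=
    aux_b _ b βs β _ _ (hpi.sub hps) hb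
  have hds : IntegrableOn (fun r => b r * s r * i r) (Icc 0 tf) :=
    aux_cont_s12 _ _ _ _ (aux_cont_s12 _ _ _ _ hbI hsc) hic
  have hdi : IntegrableOn (fun r => (b r * s r - γ) * i r) (Icc 0 tf) :=
    aux_cont_s12 _ _ _ _ ((aux_cont_s12 _ _ _ _ hbI hsc).sub continuous_const.integrableOn_Icc) hic
  have hdps : IntegrableOn (fun r => (P.pii r - P.ps r) * b r * i r) (Icc 0 tf) :=
    aux_cont_s12 _ _ _ _ hη hic
  have hdpi : IntegrableOn (fun r => (P.pii r - P.ps r) * b r * s r - γ * P.pii r) (Icc 0 tf) :=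
    (aux_cont_s12 _ _ _ _ hη hsc).sub (hpi.const_mul γ)
  have hsub : Ioc t₁ t₂ ⊆ Icc 0 tf := fun x hx => ⟨h1.trans hx.1.le, hx.2.trans h2⟩
  have ii : ∀ (g : ℝ → ℝ), IntegrableOn g (Icc 0 tf) → ∀ x ∈ Icc 0 tf, ∀ y ∈ Icc 0 tf,
      IntervalIntegrable g volume x y := by
    intro g hg x hx y hy
    exact (hg.mono_set (uIcc_subset_Icc hx hy)).intervalIntegrable
  have m0 : (0:ℝ) ∈ Icc 0 tf := ⟨le_rfl, htf.le⟩
  have mf : tf ∈ Icc 0 tf := ⟨htf.le, le_rfl⟩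
  have m1 : t₁ ∈ Icc 0 tf := ⟨h1, h12.trans h2⟩
  have mt : ∀ t ∈ Icc t₁ t₂, t ∈ Icc 0 tf := fun t ht => ⟨h1.trans ht.1, ht.2.trans h2⟩
  have hS : ∀ t ∈ Icc t₁ t₂, s t = s t₁ + ∫ x in Ioc t₁ t, -(b x * s x * i x) := by
    intro t ht
    rw [hs t, hs t₁, ← intervalIntegral.integral_of_le ht.1, intervalIntegral.integral_neg,
      ← intervalIntegral.integral_add_adjacent_intervals (ii _ hds _ m0 _ m1)
        (ii _ hds _ m1 _ (mt t ht))]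
    ring
  have hI : ∀ t ∈ Icc t₁ t₂, i t = i t₁ + ∫ x in Ioc t₁ t, (b x * s x - γ) * i x := by
    intro t ht
    rw [hi t, hi t₁, ← intervalIntegral.integral_of_le ht.1,
      ← intervalIntegral.integral_add_adjacent_intervals (ii _ hdi _ m0 _ m1)
        (ii _ hdi _ m1 _ (mt t ht))]
    ring
  -- derivative of `s i`
  let f : ℝ → ℝ := fun x => -(b x * s x * i x) * i x + s x * ((b x * s x - γ) * i x)
  have hfa : IntegrableOn (fun x => -(b x * s x * i x) * i x) (Icc 0 tf) :=
    aux_cont_s12 _ _ _ _ hds.neg hic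
  have hfb : IntegrableOn (fun x => s x * ((b x * s x - γ) * i x)) (Icc 0 tf) := by
    have := aux_cont_s12 _ _ _ _ hdi hsc
    refine this.congr (Filter.Eventually.of_forall fun x => ?_)
    ring
  have hf : IntegrableOn f (Icc 0 tf) := hfa.add hfb
  have hF : ∀ t ∈ Icc t₁ t₂, s t * i t = s t₁ * i t₁ + ∫ x in Ioc t₁ t, f x := by
    intro t ht
    have hsub' : Ioc t₁ t ⊆ Icc 0 tf := (Ioc_subset_Ioc_right ht.2).trans hsub
    have := (aux_prod volume t₁ t ht.1 _ _ s i (hds.neg.mono_set hsub') (hdi.mono_set hsub')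
      (fun x hx => hS x ⟨hx.1, hx.2.trans ht.2⟩) (fun x hx => hI x ⟨hx.1, hx.2.trans ht.2⟩)).2
    rw [integral_add (hfa.mono_set hsub') (hfb.mono_set hsub')]
    simp only [Pi.neg_apply] at this
    linarith
  let h : ℝ → ℝ := fun r => (P.pii r - P.ps r) * b r * i r -
    ((P.pii r - P.ps r) * b r * s r - γ * P.pii r)
  have hh : IntegrableOn h (Icc 0 tf) := hdps.sub hdpi
  let V1 : ℝ → ℝ := fun t => (P.pii t₁ - P.ps t₁) + ∫ x in Ioc t₁ t, h x
  let V2 : ℝ → ℝ := fun t => ∫ x in Ioc t₁ t, (-1:ℝ) ∂P.μ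
  have hV : ∀ t ∈ Icc t₁ t₂, P.pii t - P.ps t = V1 t + V2 t := by
    intro t ht
    have hm : (P.μ (Ioc t₁ tf)).toReal = (P.μ (Ioc t₁ t)).toReal + (P.μ (Ioc t tf)).toReal := by
      rw [← ENNReal.toReal_add (measure_ne_top _ _) (measure_ne_top _ _),
        ← measure_union (by
          rw [Set.disjoint_left]; intro y h h'; exact absurd h.2 (not_le.2 h'.1))
          measurableSet_Ioc, Ioc_union_Ioc_eq_Ioc ht.1 (ht.2.trans h2)]
    have hV2 : V2 t = -(P.μ (Ioc t₁ t)).toReal := by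
      simp [V2, Measure.real]
    have a1 := P.adjoint_s t (mt t ht)
    have a2 := P.adjoint_i t (mt t ht)
    have a3 := P.adjoint_s t₁ m1
    have a4 := P.adjoint_i t₁ m1
    rw [← intervalIntegral.integral_add_adjacent_intervals (ii _ hdps _ m1 _ (mt t ht))
      (ii _ hdps _ (mt t ht) _ mf)] at a3
    rw [← intervalIntegral.integral_add_adjacent_intervals (ii _ hdpi _ m1 _ (mt t ht))
      (ii _ hdpi _ (mt t ht) _ mf), hm] at a4
    have hV1 : V1 t = (P.pii t₁ - P.ps t₁) + ((∫ r in t₁..t, (P.pii r - P.ps r) * b r * i r) -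
        ∫ r in t₁..t, ((P.pii r - P.ps r) * b r * s r - γ * P.pii r)) := by
      simp only [V1, h]
      rw [← intervalIntegral.integral_of_le ht.1, intervalIntegral.integral_sub
        (ii _ hdps _ m1 _ (mt t ht)) (ii _ hdpi _ m1 _ (mt t ht))]
    rw [hV1, hV2]
    linarith
  obtain ⟨c1, e1⟩ := aux_prod volume t₁ t₂ h12 f h (fun t => s t * i t) V1 (hf.mono_set hsub)
    (hh.mono_set hsub) hF (fun t ht => by simp [V1])
  obtain ⟨c2, e2⟩ := aux_prod P.μ t₁ t₂ h12 f (fun _ => -1) (fun t => s t * i t) V2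
    (hf.mono_set hsub) (integrableOn_const (measure_ne_top _ _)) hF (fun t ht => by simp [V2])
  have c3 : IntegrableOn (fun x => s x * i x * h x) (Ioc t₁ t₂) := by
    have := (aux_cont_s12 _ _ _ _ hh (hsc.mul hic)).mono_set hsub
    refine this.congr (Filter.Eventually.of_forall fun x => ?_)
    simp only [Pi.mul_apply]
    ring
  have e3 : (∫ r in t₁..t₂, γ * s r * i r * P.ps r) =
      (∫ x in Ioc t₁ t₂, f x * V1 x) + (∫ x in Ioc t₁ t₂, s x * i x * h x) +
        ∫ x in Ioc t₁ t₂, f x * V2 x := by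
    rw [intervalIntegral.integral_of_le h12, ← integral_add c1 c3]
    have c4 : IntegrableOn (fun x => f x * V1 x + s x * i x * h x) (Ioc t₁ t₂) := c1.add c3
    rw [← integral_add c4 c2]
    refine setIntegral_congr_fun measurableSet_Ioc fun x hx => ?_
    have := hV x (Ioc_subset_Icc_self hx)
    have e : V1 x = P.pii x - P.ps x - V2 x := by linarith
    simp only [e, f, h]
    ring
  have e4 : (∫ x in Ioc t₁ t₂, s x * i x * (-1) ∂P.μ) = - ∫ x in Ioc t₁ t₂, s x * i x ∂P.μ := by
    rw [← integral_neg]; congr 1; ext x; ring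
  have v1 := hV t₁ ⟨le_rfl, h12⟩
  have v2 := hV t₂ ⟨h12, le_rfl⟩
  rw [e3, v1, v2]
  rw [e4] at e2
  linear_combination e1 + e2
end
end

section
/- Assume the Pontryagin data hold for the control b with trajectory (s,i), with λ₂ > 0 and p₀ = 1. If the switching function satisfies ψ(t) = λ₂ for every t in some nonempty open interval (t₁, t₂) ⊆ [0, t_f], then p_s(t) > 0 and i(t) = i_M for every t ∈ (t₁, t₂). -/
open MeasureTheory Set Real
open scoped ENNReal

noncomputable section

lemma aux_inv (h f : ℝ → ℝ) (h0 M u v : ℝ) (huv : u ≤ v) (hc : Continuous h)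
    (hf : LocallyIntegrable f volume)
    (hh : ∀ t, h t = h0 + ∫ r in (0:ℝ)..t, f r)
    (hp : ∀ t ∈ Icc u v, 0 < h t) (hM : ∀ t ∈ Icc u v, |f t| ≤ M) :
    ∫ r in u..v, f r / (h r)^2 = 1 / h u - 1 / h v := by
  have hint : ∀ x y, IntervalIntegrable f volume x y := fun x y =>
    ((locallyIntegrable_iff.1 hf) _ isCompact_uIcc).intervalIntegrable
  obtain ⟨x0, hx0, hmin⟩ := isCompact_Icc.exists_isMinOn (nonempty_Icc.2 huv) hc.continuousOn
  have hm : 0 < h x0 := hp x0 hx0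
  have hM0 : 0 ≤ M := (abs_nonneg _).trans (hM x0 hx0)
  have hL : LipschitzOnWith (Real.toNNReal (M / (h x0)^2)) (fun t => (h t)⁻¹) (uIcc u v) := by
    rw [uIcc_of_le huv]
    apply LipschitzOnWith.of_dist_le_mul
    intro x hx y hy
    rw [Real.coe_toNNReal _ (by positivity), Real.dist_eq, Real.dist_eq]
    have h1 : |h y - h x| ≤ M * |y - x| := by
      have : h y - h x = ∫ r in x..y, f r := by
        rw [hh y, hh x, ← intervalIntegral.integral_interval_sub_left (hint 0 y) (hint 0 x)]
        ring
      rw [this, ← Real.norm_eq_abs]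
      apply intervalIntegral.norm_integral_le_of_norm_le_const
      intro r hr
      have : r ∈ uIcc x y := uIoc_subset_uIcc hr
      exact hM r ((uIcc_subset_Icc hx hy) this)
    have hx1 := hp x hx
    have hy1 := hp y hy
    have hx2 : h x0 ≤ h x := hmin hx
    have hy2 : h x0 ≤ h y := hmin hy
    have e : (h x)⁻¹ - (h y)⁻¹ = (h y - h x) / (h x * h y) := by field_simp
    rw [e, abs_div, abs_of_pos (mul_pos hx1 hy1), abs_sub_comm x y, div_mul_eq_mul_div]
    apply div_le_div₀ (by positivity) h1 (by positivity)
    nlinarith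
  have hAC := hL.absolutelyContinuousOnInterval
  have key := hAC.integral_deriv_eq_sub
  have e2 : ∫ r in u..v, deriv (fun t => (h t)⁻¹) r = ∫ r in u..v, - (f r / (h r)^2) := by
    apply intervalIntegral.integral_congr_ae
    filter_upwards [LocallyIntegrable.ae_hasDerivAt_integral hf] with x hx hx1
    have hx2 : x ∈ Icc u v := by
      rw [uIoc_of_le huv] at hx1; exact Ioc_subset_Icc_self hx1
    have hd : HasDerivAt h (f x) x := by
      have := (hx 0).const_add h0
      have e : h = fun t => h0 + ∫ r in (0:ℝ)..t, f r := funext hh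
      rw [e]; exact this
    rw [(hd.fun_inv (hp x hx2).ne').deriv]
    ring
  rw [e2, intervalIntegral.integral_neg] at key
  simp only [one_div]
  linarith

lemma aux_bv_s13 (f : ℝ → ℝ) (tf : ℝ) (hf : BoundedVariationOn f (Icc 0 tf)) :
    IntegrableOn f (Icc 0 tf) volume := by
  obtain ⟨p, q, hp, hq, rfl⟩ := hf.locallyBoundedVariationOn.exists_monotoneOn_sub_monotoneOn
  exact (hp.integrableOn_isCompact isCompact_Icc).sub (hq.integrableOn_isCompact isCompact_Icc)

/-- if `λ₂ > 0`, `p₀ = 1` and the switching function `ψ = η s i`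
equals `λ₂` on a nonempty open interval `(t₁, t₂) ⊆ [0, tf]`, then `p_s > 0`
and `i = i_M` on `(t₁, t₂)`. -/
theorem stmt13 (γ βs β iM tf lam1 lam2 : ℝ)
    (hγ : 0 < γ) (hβs : 0 < βs) (hβ : βs < β) (hiM : 0 < iM) (hiM1 : iM < 1)
    (htf : 0 < tf) (hl1 : 0 ≤ lam1) (hl2 : 0 < lam2)
    (b s i : ℝ → ℝ) (hb : IsAdmissible βs β b)
    (htraj : IsTrajectory γ b (s 0) (i 0) s i)
    (hpos : ∀ t ∈ Set.Icc (0:ℝ) tf, 0 < s t ∧ 0 < i t ∧ i t ≤ iM)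
    (P : PontryaginData γ βs β iM tf lam1 lam2 b s i)
    (hp0 : P.p0 = 1)
    (t₁ t₂ : ℝ) (ht : t₁ < t₂) (hsub : Set.Ioo t₁ t₂ ⊆ Set.Icc (0:ℝ) tf)
    (hψ : ∀ t ∈ Set.Ioo t₁ t₂, (P.pii t - P.ps t) * s t * i t = lam2) :
    ∀ t ∈ Set.Ioo t₁ t₂, 0 < P.ps t ∧ i t = iM := by
  obtain ⟨hbm, hbb⟩ := hb
  obtain ⟨hsc, hic, hs, hi⟩ := htraj
  have hμf := P.μ_fin
  have hbbd : ∀ t, ‖b t‖ ≤ β := fun t => by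
    rw [Real.norm_eq_abs, abs_le]
    constructor <;> linarith [(hbb t).1, (hbb t).2]
  have hps := aux_bv_s13 _ _ P.ps_bv
  have hpi := aux_bv_s13 _ _ P.pi_bv
  have hbx : ∀ (S : Set ℝ) (g : ℝ → ℝ), IntegrableOn g S volume →
      IntegrableOn (fun t => b t * g t) S volume := fun S g hg =>
    Integrable.bdd_mul hg hbm.aestronglyMeasurable (Filter.Eventually.of_forall hbbd)
  -- integrability of adjoint integrands
  have hη : IntegrableOn (fun t => P.pii t - P.ps t) (Icc 0 tf) volume := hpi.sub hps
  have hA : IntegrableOn (fun t => (P.pii t - P.ps t) * b t * i t) (Icc 0 tf) volume := by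
    have := hbx _ _ (hη.mul_continuousOn hic.continuousOn isCompact_Icc)
    refine this.congr (Filter.Eventually.of_forall fun t => ?_)
    simp only []; ring
  have hB : IntegrableOn (fun t => (P.pii t - P.ps t) * b t * s t - γ * P.pii t) (Icc 0 tf)
      volume := by
    have := hbx _ _ (hη.mul_continuousOn hsc.continuousOn isCompact_Icc)
    have := this.sub (hpi.const_mul γ)
    refine this.congr (Filter.Eventually.of_forall fun t => ?_)
    simp only [Pi.sub_apply]; ring
  have hC : IntegrableOn (fun t => P.ps t * b t * s t) (Icc 0 tf) volume := by
    have := hbx _ _ (hps.mul_continuousOn hsc.continuousOn isCompact_Icc)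
    refine this.congr (Filter.Eventually.of_forall fun t => ?_)
    simp only []; ring
  have hII : ∀ g : ℝ → ℝ, IntegrableOn g (Icc 0 tf) volume → ∀ u ∈ Icc (0:ℝ) tf,
      ∀ v ∈ Icc (0:ℝ) tf, IntervalIntegrable g volume u v := fun g hg u hu v hv =>
    (hg.mono_set (uIcc_subset_Icc hu hv)).intervalIntegrable
  have htfm : tf ∈ Icc (0:ℝ) tf := ⟨htf.le, le_rfl⟩
  -- p_i * i constant
  obtain ⟨c, hcc⟩ : ∃ c, ∀ t ∈ Ioo t₁ t₂, P.pii t * i t = c := by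
    refine ⟨(lam1 + lam2 * β - P.k) / γ, fun t htm => ?_⟩
    have hae : ∀ᵐ r ∂volume, r ∈ Ioo t₁ t₂ → P.pii r * i r = (lam1 + lam2 * β - P.k) / γ := by
      have := (ae_restrict_iff' measurableSet_Icc).1 P.conservation
      filter_upwards [this] with r hr hrm
      have h1 := hr (hsub hrm)
      have h2 := hψ r hrm
      rw [hp0] at h1
      rw [eq_div_iff hγ.ne']
      have h3 : (P.pii r - P.ps r) * b r * s r * i r = lam2 * b r := by
        linear_combination b r * h2
      rw [h3] at h1
      linarith
    have hrc : ContinuousWithinAt (fun r => P.pii r * i r) (Ioi t) t :=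
      ((P.pi_rc t (hsub htm)).mul hic.continuousWithinAt).mono Ioi_subset_Ici_self
    have hfr : ∃ᶠ r in nhdsWithin t (Ioi t), P.pii r * i r = (lam1 + lam2 * β - P.k) / γ := by
      rw [Filter.Frequently]
      intro hcon
      have h2 : ∀ᶠ r in nhdsWithin t (Ioi t), r ∈ Ioo t t₂ := Ioo_mem_nhdsGT htm.2
      obtain ⟨w, hw, hw2⟩ := (mem_nhdsGT_iff_exists_Ioo_subset).1 (hcon.and h2)
      have hnull : volume (Ioo t w) = 0 := by
        apply measure_mono_null _ (ae_iff.1 hae)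
        intro r hr
        have := hw2 hr
        simp only [mem_ofPred_eq] at this ⊢
        intro hcon2
        exact this.1 (hcon2 ⟨htm.1.trans this.2.1, this.2.2⟩)
      rw [Real.volume_Ioo] at hnull
      have := ENNReal.ofReal_eq_zero.1 hnull
      have hw' : t < w := hw
      linarith
    by_contra hne
    have := hrc.tendsto.eventually_ne hne
    exact hfr this
  have hPi : ∀ t ∈ Ioo t₁ t₂, P.pii t = c / i t := fun t htm => by
    rw [eq_div_iff (hpos t (hsub htm)).2.1.ne']; exact hcc t htm
  -- the measure formula
  have hμ : ∀ u ∈ Ioo t₁ t₂, ∀ v ∈ Ioo t₁ t₂, u ≤ v →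
      (P.μ (Ioc u v)).toReal = ∫ r in u..v, P.ps r * b r * s r := by
    intro u hu v hv huv
    have hu' := hsub hu
    have hv' := hsub hv
    have hI : ∀ r ∈ Icc u v, r ∈ Ioo t₁ t₂ := fun r hr =>
      ⟨hu.1.trans_le hr.1, hr.2.trans_lt hv.2⟩
    have hloc : LocallyIntegrable (fun r => (b r * s r - γ) * i r) volume := by
      rw [locallyIntegrable_iff]
      intro K hK
      have h1 := hbx K _ ((hsc.mul hic).continuousOn.integrableOn_compact hK)
      have h2 : IntegrableOn (fun r => γ * i r) K volume :=
        (continuous_const.mul hic).continuousOn.integrableOn_compact hK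
      refine (h1.sub h2).congr (Filter.Eventually.of_forall fun t => ?_)
      simp only [Pi.sub_apply, Pi.mul_apply]; ring
    obtain ⟨M1, hM1⟩ := (isCompact_Icc (a := u) (b := v)).exists_bound_of_continuousOn
      hsc.continuousOn
    have hbound : ∀ r ∈ Icc u v, |(b r * s r - γ) * i r| ≤ (β * M1 + γ) * iM := by
      intro r hr
      have hr' := hpos r (hsub (hI r hr))
      have h1 := hM1 r hr
      have h2 := hbbd r
      rw [Real.norm_eq_abs] at h1 h2
      rw [abs_mul, abs_of_pos hr'.2.1]
      have h3 : |b r * s r - γ| ≤ β * M1 + γ := by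
        calc |b r * s r - γ| ≤ |b r * s r| + |γ| := abs_sub _ _
          _ ≤ β * M1 + γ := by
            rw [abs_mul, abs_of_pos hγ]
            gcongr
            linarith
      exact mul_le_mul h3 hr'.2.2 hr'.2.1.le ((abs_nonneg _).trans h3)
    have hinv := aux_inv i _ (i 0) _ u v huv hic hloc hi
      (fun r hr => (hpos r (hsub (hI r hr))).2.1) hbound
    have hsplit : P.pii u - P.pii v = (∫ r in u..v, ((P.pii r - P.ps r) * b r * s r - γ * P.pii r))
        + (P.μ (Ioc u v)).toReal := by
      rw [P.adjoint_i u hu', P.adjoint_i v hv',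
        ← intervalIntegral.integral_add_adjacent_intervals (hII _ hB u hu' v hv')
          (hII _ hB v hv' tf htfm), ← Ioc_union_Ioc_eq_Ioc huv hv'.2,
        measure_union (Ioc_disjoint_Ioc_of_le le_rfl) measurableSet_Ioc,
        ENNReal.toReal_add (measure_ne_top _ _) (measure_ne_top _ _)]
      ring
    have e1 : P.pii u - P.pii v = ∫ r in u..v, c * ((b r * s r - γ) * i r / (i r)^2) := by
      rw [intervalIntegral.integral_const_mul, hinv, hPi u hu, hPi v hv]; ring
    have e2 : ∫ r in u..v, c * ((b r * s r - γ) * i r / (i r)^2) =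
        ∫ r in u..v, (((P.pii r - P.ps r) * b r * s r - γ * P.pii r) + P.ps r * b r * s r) := by
      apply intervalIntegral.integral_congr
      intro r hr
      rw [uIcc_of_le huv] at hr
      have hr' := hI r hr
      have hip := (hpos r (hsub hr')).2.1
      simp only []
      rw [← hcc r hr']
      field_simp
      ring
    rw [intervalIntegral.integral_add (hII _ hB u hu' v hv') (hII _ hC u hu' v hv')] at e2
    linarith
  -- p_s strictly decreasing
  have hdec : ∀ u ∈ Ioo t₁ t₂, ∀ v ∈ Ioo t₁ t₂, u < v → P.ps v < P.ps u := by
    intro u hu v hv huv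
    have hu' := hsub hu
    have hv' := hsub hv
    have h1 : 0 < ∫ r in u..v, (P.pii r - P.ps r) * b r * i r := by
      apply intervalIntegral.intervalIntegral_pos_of_pos_on (hII _ hA u hu' v hv') _ huv
      intro r hr
      have hr' : r ∈ Ioo t₁ t₂ := ⟨hu.1.trans hr.1, hr.2.trans hv.2⟩
      have hp := hpos r (hsub hr')
      have hb0 : 0 < b r := hβs.trans_le (hbb r).1
      have h2 := hψ r hr'
      have h3 : 0 < P.pii r - P.ps r := by
        by_contra hn
        push Not at hn
        have := mul_nonpos_of_nonpos_of_nonneg hn (mul_pos hp.1 hp.2.1).le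
        rw [← mul_assoc] at this
        linarith
      exact mul_pos (mul_pos h3 hb0) hp.2.1
    rw [P.adjoint_s u hu', P.adjoint_s v hv',
        ← intervalIntegral.integral_add_adjacent_intervals (hII _ hA u hu' v hv')
          (hII _ hA v hv' tf htfm)]
    linarith
  have hpspos : ∀ t ∈ Ioo t₁ t₂, 0 < P.ps t := by
    intro t htm
    by_contra hn
    push Not at hn
    obtain ⟨v, hv1, hv2⟩ := exists_between htm.2
    obtain ⟨u, hu1, hu2⟩ := exists_between hv1
    have hu : u ∈ Ioo t₁ t₂ := ⟨htm.1.trans hu1, hu2.trans hv2⟩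
    have hv : v ∈ Ioo t₁ t₂ := ⟨htm.1.trans hv1, hv2⟩
    have h1 := hμ u hu v hv hu2.le
    have h2 : 0 < ∫ r in u..v, -(P.ps r * b r * s r) := by
      apply intervalIntegral.intervalIntegral_pos_of_pos_on
        (hII _ hC u (hsub hu) v (hsub hv)).neg _ hu2
      intro r hr
      have hr' : r ∈ Ioo t₁ t₂ := ⟨hu.1.trans hr.1, hr.2.trans hv.2⟩
      have hp := hpos r (hsub hr')
      have hb0 : 0 < b r := hβs.trans_le (hbb r).1
      have h3 := hdec t htm r hr' (hu1.trans hr.1)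
      have h4 : 0 < -P.ps r := by linarith
      have := mul_pos (mul_pos h4 hb0) hp.1
      simp only [Pi.neg_apply]
      linarith
    rw [intervalIntegral.integral_neg, ← h1] at h2
    have : 0 ≤ (P.μ (Ioc u v)).toReal := ENNReal.toReal_nonneg
    linarith
  intro t htm
  refine ⟨hpspos t htm, ?_⟩
  -- complementarity
  have hsuppae : ∀ᵐ r ∂P.μ, r ∈ Icc (0:ℝ) tf := P.μ_supp
  have hae : ∀ᵐ r ∂P.μ, i r = iM := by
    have hint : Integrable (fun r => iM - i r) P.μ := by
      obtain ⟨M, hM⟩ := (isCompact_Icc (a := (0:ℝ)) (b := tf)).exists_bound_of_continuousOn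
        (continuous_const.sub hic : Continuous fun r => iM - i r).continuousOn
      apply Integrable.of_bound (C := M)
        (continuous_const.sub hic : Continuous fun r => iM - i r).aestronglyMeasurable
      filter_upwards [hsuppae] with r hr using hM r hr
    have hz : ∫ r, (iM - i r) ∂P.μ = 0 := by
      have := P.complementarity
      rw [← neg_eq_zero, ← integral_neg] at this
      simpa using this
    have h0 := (integral_eq_zero_iff_of_nonneg_ae (by
      filter_upwards [hsuppae] with r hr
      have := (hpos r hr).2.2
      simp only [Pi.zero_apply]; linarith) hint).1 hz
    filter_upwards [h0] with r hr
    simp only [Pi.zero_apply] at hr; linarith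
  by_contra hne
  have hev : ∀ᶠ r in nhds t, i r ≠ iM ∧ r ∈ Ioo t₁ t₂ :=
    (hic.continuousAt.eventually_ne hne).and (Ioo_mem_nhds htm.1 htm.2)
  obtain ⟨ε, hε, hball⟩ := Metric.eventually_nhds_iff.1 hev
  have hin : ∀ r ∈ Icc t (t + ε/2), i r ≠ iM ∧ r ∈ Ioo t₁ t₂ := by
    intro r hr
    apply hball
    rw [Real.dist_eq, abs_lt]
    constructor <;> linarith [hr.1, hr.2]
  have hv := (hin (t + ε/2) ⟨by linarith, le_rfl⟩).2
  have h1 := hμ t htm _ hv (by linarith)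
  have h2 : P.μ (Ioc t (t + ε/2)) = 0 := by
    apply measure_mono_null _ (ae_iff.1 hae)
    intro r hr
    exact (hin r (Ioc_subset_Icc_self hr)).1
  have h3 : 0 < ∫ r in t..(t + ε/2), P.ps r * b r * s r := by
    apply intervalIntegral.intervalIntegral_pos_of_pos_on
      (hII _ hC _ (hsub htm) _ (hsub hv)) _ (by linarith)
    intro r hr
    have hr' := (hin r (Ioo_subset_Icc_self hr)).2
    exact mul_pos (mul_pos (hpspos r hr') (hβs.trans_le (hbb r).1)) (hpos r (hsub hr')).1
  rw [← h1, h2] at h3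
  simp at h3
end
end

section
/- Assume the Pontryagin data hold for the control b with trajectory (s,i), with λ₂ > 0, p₀ = 0, and the non-degeneration condition p₀ + μ([0,t_f]) + p₁ > 0. If the switching function satisfies ψ(t) = 0 for every t in some nonempty open interval (t₁, t₂) ⊆ [0, t_f], then either (a) i is constant on (t₁, t₂), or (b) k = 0, η(t) ≥ 0 for a.e. t ∈ [0, t_f], η = p_i = p_s = 0 on (t₁, t_f], p₁ = 0, and μ([0, t₁]) > 0. -/
open MeasureTheory Set Real
open scoped ENNReal

noncomputable section

/-- if `λ₂ > 0`, `p₀ = 0`, the non-degeneration condition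
`p₀ + μ([0,tf]) + p₁ > 0` holds, and the switching function `ψ = η s i`
vanishes on a nonempty open interval `(t₁, t₂) ⊆ [0, tf]`, then either
(a) `i` is constant on `(t₁, t₂)`, or (b) `k = 0`, `η ≥ 0` a.e. on `[0, tf]`,
`η = p_i = p_s = 0` on `(t₁, tf]`, `p₁ = 0` and `μ([0, t₁]) > 0`. -/
theorem stmt14 (γ βs β iM tf lam1 lam2 : ℝ)
    (hγ : 0 < γ) (hβs : 0 < βs) (hβ : βs < β) (hiM : 0 < iM) (hiM1 : iM < 1)
    (htf : 0 < tf) (hl1 : 0 ≤ lam1) (hl2 : 0 < lam2)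
    (b s i : ℝ → ℝ) (hb : IsAdmissible βs β b)
    (htraj : IsTrajectory γ b (s 0) (i 0) s i)
    (hpos : ∀ t ∈ Set.Icc (0:ℝ) tf, 0 < s t ∧ 0 < i t ∧ i t ≤ iM)
    (P : PontryaginData γ βs β iM tf lam1 lam2 b s i)
    (hp0 : P.p0 = 0)
    (hnd : 0 < P.p0 + (P.μ (Set.Icc (0:ℝ) tf)).toReal + P.p1)
    (t₁ t₂ : ℝ) (ht : t₁ < t₂) (hsub : Set.Ioo t₁ t₂ ⊆ Set.Icc (0:ℝ) tf)
    (hψ : ∀ t ∈ Set.Ioo t₁ t₂, (P.pii t - P.ps t) * s t * i t = 0) :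
    (∀ t ∈ Set.Ioo t₁ t₂, ∀ t' ∈ Set.Ioo t₁ t₂, i t = i t') ∨
    (P.k = 0 ∧
      (∀ᵐ t ∂(volume.restrict (Set.Icc (0:ℝ) tf)), 0 ≤ P.pii t - P.ps t) ∧
      (∀ t ∈ Set.Ioc t₁ tf, P.pii t - P.ps t = 0 ∧ P.pii t = 0 ∧ P.ps t = 0) ∧
      P.p1 = 0 ∧
      0 < P.μ (Set.Icc (0:ℝ) t₁)) := by
  have h1 : 0 ≤ t₁ := by
    by_contra h
    push Not at h
    obtain ⟨x, hx1, hx2⟩ := exists_between (lt_min ht h)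
    have := (hsub ⟨hx1, hx2.trans_le (min_le_left _ _)⟩).1
    linarith [min_le_right t₂ 0]
  have h2 : t₂ ≤ tf := by
    by_contra h
    push Not at h
    obtain ⟨x, hx1, hx2⟩ := exists_between (max_lt ht h)
    have := (hsub ⟨(le_max_left _ _).trans_lt hx1, hx2⟩).2
    linarith [le_max_right t₁ tf]
  have hη : ∀ t ∈ Set.Ioo t₁ t₂, P.pii t - P.ps t = 0 := by
    intro t htt
    obtain ⟨hs, hi, _⟩ := hpos t (hsub htt)
    have := hψ t htt
    simpa [hs.ne', hi.ne'] using this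
  have hconst0 : ∀ t ∈ Set.Ioo t₁ t₂, ∀ t' ∈ Set.Ioo t₁ t₂, t ≤ t' → P.ps t = P.ps t' := by
    intro t htt t' htt' hle
    rw [P.adjoint_s t (hsub htt), P.adjoint_s t' (hsub htt'),
      intervalIntegral.integral_of_le (hsub htt).2,
      intervalIntegral.integral_of_le (hsub htt').2]
    congr 1
    refine setIntegral_eq_of_subset_of_forall_sdiff_eq_zero measurableSet_Ioc
      (Set.Ioc_subset_Ioc_left hle) ?_
    rintro x ⟨⟨hx1, hx2⟩, hx3⟩
    have hx : x ≤ t' := by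
      by_contra h
      exact hx3 ⟨not_le.mp h, hx2⟩
    rw [hη x ⟨htt.1.trans hx1, hx.trans_lt htt'.2⟩]
    ring
  obtain ⟨m, hm⟩ : (Set.Ioo t₁ t₂).Nonempty := Set.nonempty_Ioo.mpr ht
  set c := P.ps m with hc
  have hps : ∀ t ∈ Set.Ioo t₁ t₂, P.ps t = c := by
    intro t htt
    rcases le_total t m with h | h
    · exact hconst0 t htt m hm h
    · exact (hconst0 m hm t htt h).symm
  have hpi : ∀ t ∈ Set.Ioo t₁ t₂, P.pii t = c := by
    intro t htt
    have := hη t htt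
    rw [hps t htt] at this
    linarith
  have hcons : Set.EqOn (fun t => -(γ * c * i t)) (fun _ => P.k) (Set.Ioo t₁ t₂) := by
    refine Measure.eqOn_open_of_ae_eq (μ := volume) ?_ isOpen_Ioo
      ((htraj.2.1.const_mul (γ * c)).neg.continuousOn) continuousOn_const
    have hA := ae_restrict_of_ae_restrict_of_subset hsub P.conservation
    filter_upwards [hA, ae_restrict_mem measurableSet_Ioo] with t hA htt
    rw [hp0, hη t htt, hpi t htt] at hA
    linarith
  by_cases hc0 : c = 0
  swap
  · left
    intro t htt t' htt'
    have e1 := hcons htt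
    have e2 := hcons htt'
    simp only at e1 e2
    have : γ * c * i t = γ * c * i t' := by linarith
    exact mul_left_cancel₀ (mul_ne_zero hγ.ne' hc0) this
  right
  have hk : P.k = 0 := by
    have := hcons hm
    simp only [hc0] at this
    linarith
  have hae : ∀ᵐ t ∂(volume.restrict (Set.Icc (0:ℝ) tf)),
      (P.pii t - P.ps t) * b t * s t - γ * P.pii t = 0 := by
    filter_upwards [P.conservation, ae_restrict_mem measurableSet_Icc] with t hA htt
    obtain ⟨hs, hi, _⟩ := hpos t htt
    rw [hp0, hk] at hA
    have : ((P.pii t - P.ps t) * b t * s t - γ * P.pii t) * i t = 0 := by linarith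
    simpa [hi.ne'] using this
  have hpiμ : ∀ t ∈ Set.Icc (0:ℝ) tf, P.pii t = (P.μ (Set.Ioc t tf)).toReal := by
    intro t htt
    have : ∫ r in t..tf, ((P.pii r - P.ps r) * b r * s r - γ * P.pii r) = 0 := by
      rw [intervalIntegral.integral_of_le htt.2]
      refine integral_eq_zero_of_ae ?_
      exact ae_restrict_of_ae_restrict_of_subset
        (fun x hx => ⟨htt.1.trans hx.1.le, hx.2⟩ : Set.Ioc t tf ⊆ Set.Icc (0:ℝ) tf) hae
    rw [P.adjoint_i t htt, this, zero_add]
  have hfin := P.μ_fin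
  have hμ0 : ∀ t ∈ Set.Ioc t₁ tf, P.μ (Set.Ioc t tf) = 0 := by
    intro t htt
    obtain ⟨x, hx1, hx2⟩ := exists_between (lt_min htt.1 ht)
    have hx : x ∈ Set.Ioo t₁ t₂ := ⟨hx1, hx2.trans_le (min_le_right _ _)⟩
    have e := hpiμ x (hsub hx)
    rw [hpi x hx, hc0] at e
    have e' : P.μ (Set.Ioc x tf) = 0 := by
      rcases (ENNReal.toReal_eq_zero_iff _).mp e.symm with h | h
      · exact h
      · exact absurd h (measure_ne_top _ _)
    exact measure_mono_null
      (Set.Ioc_subset_Ioc_left (hx2.trans_le (min_le_left _ _)).le) e'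
  have hpi0 : ∀ t ∈ Set.Ioc t₁ tf, P.pii t = 0 := by
    intro t htt
    rw [hpiμ t ⟨h1.trans htt.1.le, htt.2⟩, hμ0 t htt]
    rfl
  have hsign : ∀ᵐ t ∂(volume.restrict (Set.Icc (0:ℝ) tf)),
      (P.pii t - P.ps t) = γ * P.pii t / (b t * s t) := by
    filter_upwards [hae, ae_restrict_mem measurableSet_Icc] with t hA htt
    obtain ⟨hs, hi, _⟩ := hpos t htt
    have hbt : 0 < b t := hβs.trans_le (hb.2 t).1
    rw [eq_div_iff (by positivity)]
    linarith
  have hpsp1 : ∀ t ∈ Set.Ioc t₁ tf, P.ps t = P.p1 := by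
    intro t htt
    have : ∫ r in t..tf, (P.pii r - P.ps r) * b r * i r = 0 := by
      rw [intervalIntegral.integral_of_le htt.2]
      refine integral_eq_zero_of_ae ?_
      have hA := ae_restrict_of_ae_restrict_of_subset
        (fun x hx => ⟨h1.trans (htt.1.trans hx.1).le, hx.2⟩ :
          Set.Ioc t tf ⊆ Set.Icc (0:ℝ) tf) hsign
      filter_upwards [hA, ae_restrict_mem measurableSet_Ioc] with x hA hx
      rw [hA, hpi0 x ⟨htt.1.trans hx.1, hx.2⟩]
      simp
    rw [P.adjoint_s t ⟨h1.trans htt.1.le, htt.2⟩, this, add_zero]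
  have hp1 : P.p1 = 0 := by
    rw [← hpsp1 m ⟨hm.1, (hsub hm).2⟩, ← hc, hc0]
  refine ⟨hk, ?_, ?_, hp1, ?_⟩
  · filter_upwards [hsign, ae_restrict_mem measurableSet_Icc] with t hA htt
    obtain ⟨hs, hi, _⟩ := hpos t htt
    have hbt : 0 < b t := hβs.trans_le (hb.2 t).1
    have hp : 0 ≤ P.pii t := by
      rw [hpiμ t htt]
      exact ENNReal.toReal_nonneg
    rw [hA]
    positivity
  · intro t htt
    rw [hpsp1 t htt, hpi0 t htt, hp1]
    simp
  · rw [pos_iff_ne_zero]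
    intro h0
    have hI : P.μ (Set.Ioc t₁ tf) = 0 := by
      have hsubU : Set.Ioc t₁ tf ⊆
          ⋃ n : ℕ, Set.Ioc (t₁ + (tf - t₁) / ((n : ℝ) + 1 + 1)) tf := by
        intro x hx
        obtain ⟨n, hn⟩ := exists_nat_gt ((tf - t₁) / (x - t₁))
        refine Set.mem_iUnion.mpr ⟨n, ?_, hx.2⟩
        have hxp : 0 < x - t₁ := sub_pos.mpr hx.1
        rw [div_lt_iff₀ hxp] at hn
        have : (tf - t₁) / ((n : ℝ) + 1 + 1) < x - t₁ := by
          rw [div_lt_iff₀ (by positivity)]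
          nlinarith
        linarith
      refine measure_mono_null hsubU (measure_iUnion_null fun n => hμ0 _ ?_)
      have hd : 0 < tf - t₁ := by linarith
      have hn : (0:ℝ) ≤ n := Nat.cast_nonneg n
      constructor
      · have : 0 < (tf - t₁) / ((n : ℝ) + 1 + 1) := by positivity
        linarith
      · have : (tf - t₁) / ((n : ℝ) + 1 + 1) ≤ tf - t₁ := by
          apply div_le_self hd.le
          linarith
        linarith
    have hT : P.μ (Set.Icc (0:ℝ) tf) = 0 := by
      rw [← Set.Icc_union_Ioc_eq_Icc h1 (by linarith : t₁ ≤ tf)]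
      exact measure_union_null h0 hI
    rw [hp0, hT, hp1] at hnd
    simp at hnd
end
end

section
/- Let b be an admissible control whose trajectory (s,i) from (s₀,i₀) satisfies i(t) = c for all t in an interval [t₁, t₂] (t₁ < t₂), where c ∈ (0, i_M] is a constant. Then: (1) s(t) = s(t₁) − γ c (t − t₁) for all t ∈ [t₁, t₂]; (2) b(t) = γ / s(t) for almost every t ∈ (t₁, t₂); (3) s(t₁) ≤ γ/β_* and s(t₂) ≥ γ/β. In particular, the time length of such an arc satisfies t₂ − t₁ = (s(t₁) − s(t₂)) / (γ c). -/
open MeasureTheory Set Real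
open scoped ENNReal

noncomputable section

/-- along an arc on which the infected population is constant,
`i ≡ c ∈ (0, i_M]` on `[t₁, t₂]`: (1) `s(t) = s(t₁) − γ c (t − t₁)` on
`[t₁, t₂]`; (2) `b(t) = γ / s(t)` a.e. on `(t₁, t₂)`; (3) `s(t₁) ≤ γ/β_*`
and `s(t₂) ≥ γ/β`; in particular `t₂ − t₁ = (s(t₁) − s(t₂)) / (γ c)`. -/
theorem stmt15 (γ βs β iM : ℝ) (hγ : 0 < γ) (hβs : 0 < βs) (hβ : βs < β)
    (hiM : 0 < iM) (hiM1 : iM < 1)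
    (s₀ i₀ : ℝ) (hs₀ : 0 ≤ s₀) (hi₀ : 0 ≤ i₀)
    (b s i : ℝ → ℝ) (hb : IsAdmissible βs β b)
    (htraj : IsTrajectory γ b s₀ i₀ s i)
    (t₁ t₂ c : ℝ) (ht : t₁ < t₂) (hc : 0 < c) (hc' : c ≤ iM)
    (hconst : ∀ t ∈ Set.Icc t₁ t₂, i t = c) :
    (∀ t ∈ Set.Icc t₁ t₂, s t = s t₁ - γ * c * (t - t₁)) ∧
    (∀ᵐ t : ℝ, t ∈ Set.Ioo t₁ t₂ → b t = γ / s t) ∧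
    s t₁ ≤ γ / βs ∧ γ / β ≤ s t₂ ∧
    t₂ - t₁ = (s t₁ - s t₂) / (γ * c) := by
  obtain ⟨hbm, hbI⟩ := hb
  obtain ⟨hsc, hic, hs, hi⟩ := htraj
  have hbL : LocallyIntegrable b volume := by
    refine (locallyIntegrable_const β).mono hbm.aestronglyMeasurable (Filter.Eventually.of_forall fun t => ?_)
    have h1 := hbI t
    rw [Real.norm_eq_abs, Real.norm_eq_abs, abs_of_pos (hβs.trans_le h1.1), abs_of_pos (hβs.trans hβ)]
    exact h1.2
  have hbi : ∀ x y : ℝ, IntervalIntegrable b volume x y := fun x y =>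
    intervalIntegrable_iff.mpr ((hbL.integrableOn_isCompact isCompact_uIcc).mono_set uIoc_subset_uIcc)
  have hf1 : ∀ x y : ℝ, IntervalIntegrable (fun r => b r * s r * i r) volume x y := fun x y =>
    ((hbi x y).mul_continuousOn hsc.continuousOn).mul_continuousOn hic.continuousOn
  have hf2 : ∀ x y : ℝ, IntervalIntegrable (fun r => (b r * s r - γ) * i r) volume x y := fun x y =>
    (((hbi x y).mul_continuousOn hsc.continuousOn).sub
      intervalIntegrable_const).mul_continuousOn hic.continuousOn
  have h1 : ∀ t ∈ Set.Icc t₁ t₂, s t = s t₁ - γ * c * (t - t₁) := by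
    intro t htt
    have e1 : s t - s t₁ = -∫ r in t₁..t, b r * s r * i r := by
      rw [hs t, hs t₁, ← intervalIntegral.integral_interval_sub_left (hf1 0 t) (hf1 0 t₁)]
      ring
    have e2 : i t - i t₁ = ∫ r in t₁..t, (b r * s r - γ) * i r := by
      rw [hi t, hi t₁, ← intervalIntegral.integral_interval_sub_left (hf2 0 t) (hf2 0 t₁)]
      ring
    have e3 : (∫ r in t₁..t, b r * s r * i r) - (∫ r in t₁..t, (b r * s r - γ) * i r)
        = ∫ r in t₁..t, γ * c := by
      rw [← intervalIntegral.integral_sub (hf1 _ _) (hf2 _ _)]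
      refine intervalIntegral.integral_congr fun r hr => ?_
      rw [uIcc_of_le htt.1] at hr
      rw [hconst r ⟨hr.1, hr.2.trans htt.2⟩]
      ring
    rw [intervalIntegral.integral_const, smul_eq_mul] at e3
    rw [hconst t htt, hconst t₁ ⟨le_rfl, ht.le⟩] at e2
    linarith
  have h2 : ∀ᵐ t : ℝ, t ∈ Set.Ioo t₁ t₂ → b t * s t = γ := by
    filter_upwards [(hf2 t₁ t₂).ae_hasDerivAt_integral] with t hd htt
    have hd := hd (by rw [uIcc_of_le ht.le]; exact Ioo_subset_Icc_self htt) t₁ (by simp)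
    have hz : HasDerivAt (fun x => ∫ r in t₁..x, (b r * s r - γ) * i r) 0 t := by
      refine (hasDerivAt_const t (0:ℝ)).congr_of_eventuallyEq ?_
      filter_upwards [Ioo_mem_nhds htt.1 htt.2] with x hx
      rw [← intervalIntegral.integral_interval_sub_left (hf2 0 x) (hf2 0 t₁)]
      have a1 := hi x
      have a2 := hi t₁
      rw [hconst x (Ioo_subset_Icc_self hx)] at a1
      rw [hconst t₁ ⟨le_rfl, ht.le⟩] at a2
      linarith
    have h0 := hd.unique hz
    rw [hconst t (Ioo_subset_Icc_self htt)] at h0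
    rcases mul_eq_zero.1 h0 with h | h <;> linarith
  have h3 : EqOn s (fun t => max (γ / β) (min (s t) (γ / βs))) (Icc t₁ t₂) := by
    refine Measure.eqOn_Icc_of_ae_eq volume ht.ne ?_ hsc.continuousOn
      (by fun_prop)
    rw [← Measure.restrict_congr_set (Ioo_ae_eq_Icc (μ := volume) (a := t₁) (b := t₂))]
    refine (ae_restrict_iff' measurableSet_Ioo).2 ?_
    filter_upwards [h2] with t h htt
    have h := h htt
    have hb1 := hbI t
    have hbp := hβs.trans_le hb1.1
    have hsp : 0 < s t := by
      by_contra hn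
      nlinarith
    have l1 : γ / β ≤ s t := by
      rw [div_le_iff₀ (hβs.trans hβ)]
      nlinarith [hb1.2]
    have l2 : s t ≤ γ / βs := by
      rw [le_div_iff₀ hβs]
      nlinarith [hb1.1]
    rw [min_eq_left l2, max_eq_right l1]
  refine ⟨h1, ?_, ?_, ?_, ?_⟩
  · filter_upwards [h2] with t h htt
    have h := h htt
    have : s t ≠ 0 := by
      rintro h0
      rw [h0] at h
      linarith
    rw [eq_div_iff this, h]
  · rw [h3 (left_mem_Icc.2 ht.le)]
    refine max_le ?_ (min_le_right _ _)
    exact div_le_div_of_nonneg_left hγ.le hβs hβ.le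
  · rw [h3 (right_mem_Icc.2 ht.le)]
    exact le_max_left _ _
  · rw [h1 t₂ (right_mem_Icc.2 ht.le), eq_div_iff (by positivity)]
    ring
end
end

section
/- Assume the Pontryagin data hold for the control b with trajectory (s,i) from (s₀,i₀), with λ₂ > 0, p₁ = 0, and the non-degeneration condition p₀ + μ([0,t_f]) + p₁ > 0. Assume further (s₀, i₀) ∈ 𝕋 lies in the interior of the no-effort zone, i.e. i₀ < Φ_A(s₀) and i₀ > 0, and that s(t_f) < γ/β. Then b(t) = β for almost every t ∈ [0, t_f]. -/
open MeasureTheory Set Real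
open scoped ENNReal

noncomputable section

lemma aux_gronwall (w : ℝ → ℝ) (T K M : ℝ) (hM : ∀ t ∈ Icc (0:ℝ) T, w t ≤ M)
    (h : ∀ g : ℝ → ℝ, Continuous g → (∀ t ∈ Icc (0:ℝ) T, w t ≤ g t) →
      ∀ t ∈ Icc (0:ℝ) T, w t ≤ K * ∫ r in t..T, g r) :
    ∀ t ∈ Icc (0:ℝ) T, w t ≤ 0 := by
  have key : ∀ n : ℕ, ∀ t ∈ Icc (0:ℝ) T, w t ≤ M * ((K * (T - t)) ^ n / (n.factorial : ℝ)) := by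
    intro n
    induction n with
    | zero => intro t ht; simpa using hM t ht
    | succ n ih =>
      intro t ht
      have h1 := h _ (by fun_prop) ih t ht
      refine h1.trans (le_of_eq ?_)
      have h2 : ∫ r in t..T, M * ((K * (T - r)) ^ n / (n.factorial : ℝ)) =
          (M * K ^ n / (n.factorial : ℝ)) * ∫ r in t..T, (T - r) ^ n := by
        rw [← intervalIntegral.integral_const_mul]
        congr 1
        ext r
        rw [mul_pow]; ring
      have h3 : ∫ r in t..T, (T - r) ^ n = (T - t) ^ (n + 1) / (n + 1) := by
        rw [intervalIntegral.integral_comp_sub_left (fun x => x ^ n) T, integral_pow]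
        simp
      rw [h2, h3, Nat.factorial_succ]
      have : (n.factorial : ℝ) ≠ 0 := by positivity
      have : (n : ℝ) + 1 ≠ 0 := by positivity
      push_cast
      rw [mul_pow]
      field_simp
      try ring
  intro t ht
  have hl := (FloorSemiring.tendsto_pow_div_factorial_atTop (K * (T - t))).const_mul M
  rw [mul_zero] at hl
  exact ge_of_tendsto' hl (fun n => key n t ht)

lemma aux_below (γ βs β iM sM tf : ℝ)
    (hγ : 0 < γ) (hβs : 0 < βs) (hβ : βs < β)
    (b s i : ℝ → ℝ) (hb : IsAdmissible βs β b)
    (htraj : IsTrajectory γ b (s 0) (i 0) s i)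
    (hpos : ∀ t ∈ Set.Icc (0:ℝ) tf, 0 < s t ∧ 0 < i t ∧ i t ≤ iM)
    (hi0 : 0 < i 0)
    (hint : i 0 < Phi γ β iM sM (s 0)) :
    ∀ t ∈ Set.Icc (0:ℝ) tf, i t < iM := by
  intro t ht
  obtain ⟨hsc, hic, hs, hi⟩ := htraj
  obtain ⟨hbm, hbI⟩ := hb
  have hβ0 : 0 < β := hβs.trans hβ
  have hbb : ∀ r, ‖b r‖ ≤ β := fun r => by
    rw [Real.norm_eq_abs, abs_le]; constructor <;> linarith [(hbI r).1, (hbI r).2]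
  have hbint : LocallyIntegrable b volume :=
    (locallyIntegrable_const β).mono hbm.aestronglyMeasurable
      (Filter.Eventually.of_forall fun r => (hbb r).trans (le_abs_self β))
  have hbi : ∀ g : ℝ → ℝ, Continuous g → LocallyIntegrable (fun r => b r * g r) volume := by
    intro g hg
    have := (locallyIntegrableOn_univ.2 hbint).mul_continuousOn hg.continuousOn
      isClosed_univ.isLocallyClosed
    exact locallyIntegrableOn_univ.1 this
  have hgs : LocallyIntegrable (fun r => b r * s r * i r) volume := by
    simpa only [mul_assoc] using hbi (fun r => s r * i r) (by fun_prop)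
  have hgi : LocallyIntegrable (fun r => (b r * s r - γ) * i r) volume := by
    have h1 : LocallyIntegrable (fun r => γ * i r) volume :=
      Continuous.locallyIntegrable (by fun_prop)
    have := hgs.sub h1
    refine this.congr (Filter.Eventually.of_forall fun r => ?_)
    simp only [Pi.sub_apply]; ring
  have hii : ∀ {g : ℝ → ℝ}, LocallyIntegrable g volume → ∀ x y,
      IntervalIntegrable g volume x y := fun hg x y =>
    intervalIntegrable_iff.2
      ((hg.integrableOn_isCompact isCompact_uIcc).mono_set uIoc_subset_uIcc)
  have hsub : ∀ r ∈ Icc (0:ℝ) t, 0 < s r ∧ 0 < i r ∧ i r ≤ iM :=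
    fun r hr => hpos r ⟨hr.1, hr.2.trans ht.2⟩
  have ht0 := ht.1
  unfold Phi at hint
  split_ifs at hint with h1 h2
  · have hsle : ∀ r ∈ Icc (0:ℝ) t, s r ≤ γ / β := by
      intro r hr
      rw [hs r]
      have : 0 ≤ ∫ r in (0:ℝ)..r, b r * s r * i r := by
        apply intervalIntegral.integral_nonneg hr.1
        intro u hu
        have := hsub u ⟨hu.1, hu.2.trans hr.2⟩
        have h3 := (hbI u).1
        have h4 := this.1
        have h5 := this.2.1
        have h6 : 0 ≤ b u := by linarith
        positivity
      linarith
    have : (∫ r in (0:ℝ)..t, (b r * s r - γ) * i r) ≤ 0 := by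
      rw [← neg_nonneg, ← intervalIntegral.integral_neg]
      apply intervalIntegral.integral_nonneg ht0
      intro u hu
      have h3 := hsub u hu
      have h4 := hsle u hu
      rw [le_div_iff₀ hβ0] at h4
      rw [neg_nonneg]
      apply mul_nonpos_of_nonpos_of_nonneg _ h3.2.1.le
      nlinarith [(hbI u).2, h3.1]
    rw [hi t]; linarith
  · have hsneg : ∀ x y, s y - s x = -∫ r in x..y, b r * s r * i r := by
      intro x y
      rw [hs y, hs x, ← intervalIntegral.integral_interval_sub_left (hii hgs 0 y) (hii hgs 0 x)]
      ring
    set c := γ / β with hc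
    have hc0 : 0 < c := by positivity
    -- absolute continuity
    have hsac : AbsolutelyContinuousOnInterval s 0 t := by
      have h3 := (hii hgs 0 t).absolutelyContinuousOnInterval_intervalIntegral (c := 0) (by simp)
      have h4 : AbsolutelyContinuousOnInterval (fun _ : ℝ => s 0) 0 t :=
        (LipschitzWith.const (s 0)).lipschitzOnWith.absolutelyContinuousOnInterval
      have h5 := h4.sub h3
      have h6 : s = (fun _ : ℝ => s 0) - _ := funext hs
      rw [h6]
      exact h5
    have hiac : AbsolutelyContinuousOnInterval i 0 t := by
      have h3 := (hii hgi 0 t).absolutelyContinuousOnInterval_intervalIntegral (c := 0) (by simp)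
      have h4 : AbsolutelyContinuousOnInterval (fun _ : ℝ => i 0) 0 t :=
        (LipschitzWith.const (i 0)).lipschitzOnWith.absolutelyContinuousOnInterval
      have h5 := h4.add h3
      have h6 : i = (fun _ : ℝ => i 0) + _ := funext hi
      rw [h6]
      exact h5
    have hlac : AbsolutelyContinuousOnInterval (fun r => Real.log (s r)) 0 t := by
      obtain ⟨x0, hx0, hmin⟩ := isCompact_Icc.exists_isMinOn (nonempty_Icc.2 ht0)
        hsc.continuousOn
      obtain ⟨C, hC⟩ := isCompact_Icc.exists_bound_of_continuousOn (s := Icc 0 t)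
        (f := fun r => s r * i r) (by fun_prop)
      have hm := (hsub x0 hx0).1
      have hC0 : 0 ≤ C := (norm_nonneg _).trans (hC 0 ⟨le_rfl, ht0⟩)
      have hL : LipschitzOnWith (Real.toNNReal (β * C / s x0)) (fun r => Real.log (s r))
          (uIcc 0 t) := by
        rw [uIcc_of_le ht0]
        apply LipschitzOnWith.of_le_add_mul'
        intro x hx y hy
        have hsx := (hsub x hx).1
        have hsy := (hsub y hy).1
        have h3 : Real.log (s x) - Real.log (s y) ≤ s x / s y - 1 := by
          rw [← Real.log_div hsx.ne' hsy.ne']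
          exact Real.log_le_sub_one_of_pos (by positivity)
        have h4 : |s x - s y| ≤ β * C * |x - y| := by
          rw [hsneg y x, abs_neg, ← Real.norm_eq_abs]
          refine intervalIntegral.norm_integral_le_of_norm_le_const ?_
          intro r hr
          have hr' : r ∈ Icc 0 t := by
            have := uIoc_subset_uIcc hr
            exact (ordConnected_Icc.uIcc_subset hy hx) this
          rw [mul_assoc, norm_mul]
          exact mul_le_mul (hbb r) (hC r hr') (norm_nonneg _) hβ0.le
        have h5 : s x0 ≤ s y := hmin hy
        have h6 : s x / s y - 1 ≤ β * C / s x0 * |x - y| := by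
          have : s x / s y - 1 = (s x - s y) / s y := by field_simp
          rw [this]
          calc (s x - s y) / s y ≤ (β * C * |x - y|) / s y := by
                gcongr; exact (le_abs_self _).trans h4
            _ ≤ (β * C * |x - y|) / s x0 := by gcongr
            _ = _ := by ring
        rw [Real.dist_eq]
        linarith
      exact hL.absolutelyContinuousOnInterval
    have hV : AbsolutelyContinuousOnInterval (fun r => (i r + s r) - c * Real.log (s r)) 0 t :=
      (hiac.add hsac).sub (hlac.const_mul c)
    have hVd : ∀ᵐ r, r ∈ Icc 0 t →
        deriv (fun r => (i r + s r) - c * Real.log (s r)) r ≤ 0 := by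
      filter_upwards [LocallyIntegrable.ae_hasDerivAt_integral hgs,
        LocallyIntegrable.ae_hasDerivAt_integral hgi] with r h3 h4 hr
      have hr' := hsub r hr
      have h5 : HasDerivAt s (-(b r * s r * i r)) r := by
        have := (h3 0).const_sub (s 0)
        exact this.congr_of_eventuallyEq (Filter.Eventually.of_forall hs)
      have h6 : HasDerivAt i ((b r * s r - γ) * i r) r := by
        have := (h4 0).const_add (i 0)
        exact this.congr_of_eventuallyEq (Filter.Eventually.of_forall hi)
      have h7 := (h6.add h5).sub ((h5.log hr'.1.ne').const_mul c)
      have h8 : deriv (fun r => (i r + s r) - c * Real.log (s r)) r = _ := h7.deriv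
      rw [h8]
      have h9 : (b r * s r - γ) * i r + -(b r * s r * i r) - c * (-(b r * s r * i r) / s r)
          = (c * b r - γ) * i r := by
        have := hr'.1.ne'
        field_simp
        ring
      rw [h9]
      apply mul_nonpos_of_nonpos_of_nonneg _ hr'.2.1.le
      have : c * β = γ := by rw [hc]; field_simp
      nlinarith [(hbI r).2]
    have hVi : ∫ r in (0:ℝ)..t, deriv (fun r => (i r + s r) - c * Real.log (s r)) r ≤ 0 := by
      rw [intervalIntegral.integral_of_le ht0]
      apply integral_nonpos_of_ae
      rw [Filter.EventuallyLE, ae_restrict_iff' measurableSet_Ioc]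
      filter_upwards [hVd] with r h3 hr
      exact h3 (Ioc_subset_Icc_self hr)
    rw [hV.integral_deriv_eq_sub] at hVi
    have hs0 := (hsub 0 ⟨le_rfl, ht0⟩).1
    have hst := (hsub t ⟨ht0, le_rfl⟩).1
    have e1 : β * s 0 / γ = s 0 / c := by rw [hc]; field_simp
    rw [e1, Real.log_div hs0.ne' hc0.ne'] at hint
    have e2 := Real.log_le_sub_one_of_pos (div_pos hst hc0)
    rw [Real.log_div hst.ne' hc0.ne'] at e2
    have e3 := mul_le_mul_of_nonneg_left e2 hc0.le
    have e4 : c * (s t / c - 1) = s t - c := by field_simp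
    rw [e4] at e3
    nlinarith
  · linarith

/-- under the Pontryagin data with `λ₂ > 0`, `p₁ = 0` and the
non-degeneration condition, if the initial datum lies in the interior of the
no-effort zone (`0 < i 0 < Φ_A(s 0)`, in `𝕋`) and `s(tf) < γ/β`, then
`b = β` almost everywhere on `[0, tf]`. -/
theorem stmt16 (γ βs β iM sM tf lam1 lam2 : ℝ)
    (hγ : 0 < γ) (hβs : 0 < βs) (hβ : βs < β) (hiM : 0 < iM) (hiM1 : iM < 1)
    (hsM : γ / β < sM)
    (hsM' : iM - sM + γ / β + (γ / β) * Real.log (β * sM / γ) = 0)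
    (htf : 0 < tf) (hl1 : 0 ≤ lam1) (hl2 : 0 < lam2)
    (b s i : ℝ → ℝ) (hb : IsAdmissible βs β b)
    (htraj : IsTrajectory γ b (s 0) (i 0) s i)
    (hpos : ∀ t ∈ Set.Icc (0:ℝ) tf, 0 < s t ∧ 0 < i t ∧ i t ≤ iM)
    (P : PontryaginData γ βs β iM tf lam1 lam2 b s i)
    (hp1 : P.p1 = 0)
    (hnd : 0 < P.p0 + (P.μ (Set.Icc (0:ℝ) tf)).toReal + P.p1)
    (hT : MemT (s 0) (i 0)) (hi0 : 0 < i 0)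
    (hint : i 0 < Phi γ β iM sM (s 0))
    (hsf : s tf < γ / β) :
    ∀ᵐ t ∂(volume.restrict (Set.Icc (0:ℝ) tf)), b t = β := by
  have hbelow := aux_below γ βs β iM sM tf hγ hβs hβ b s i hb htraj hpos hi0 hint
  obtain ⟨hsc, hic, -, -⟩ := htraj
  have hbb : ∀ r, |b r| ≤ β := fun r => by
    rw [abs_le]; constructor <;> linarith [(hb.2 r).1, (hb.2 r).2]
  have hβ0 : 0 < β := hβs.trans hβ
  have := P.μ_fin
  -- the measure vanishes
  have hμ : P.μ (Icc (0:ℝ) tf) = 0 := by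
    have hrestr : P.μ.restrict (Icc (0:ℝ) tf) = P.μ :=
      Measure.restrict_eq_self_of_ae_mem (by
        rw [ae_iff]; exact P.μ_supp)
    have hae : ∀ᵐ t ∂P.μ, t ∈ Icc (0:ℝ) tf := by rw [ae_iff]; exact P.μ_supp
    have hInt : Integrable (fun t => iM - i t) P.μ := by
      rw [← hrestr]
      exact ContinuousOn.integrableOn_compact isCompact_Icc (by fun_prop)
    have h0 : ∫ t, (iM - i t) ∂P.μ = 0 := by
      have := P.complementarity
      rw [← neg_eq_zero, ← integral_neg] at this
      rw [← this]; congr 1; ext t; ring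
    have h1 := (integral_eq_zero_iff_of_nonneg_ae (by
      filter_upwards [hae] with t ht
      have := hbelow t ht
      simp only [Pi.zero_apply]; linarith) hInt).1 h0
    have h2 : ∀ᵐ t ∂P.μ, t ∉ Icc (0:ℝ) tf := by
      filter_upwards [h1] with t h3 h4
      have := hbelow t h4
      simp only [Pi.zero_apply] at h3
      linarith
    rw [ae_iff] at h2
    simpa only [not_not, Set.setOf_mem_eq] using h2
  have hp0 : 0 < P.p0 := by
    rw [hμ, hp1] at hnd
    simpa using hnd
  -- the adjoint states vanish
  obtain ⟨Cs, hCs⟩ := isCompact_Icc.exists_bound_of_continuousOn (s := Icc 0 tf) hsc.continuousOn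
  obtain ⟨Ci, hCi⟩ := isCompact_Icc.exists_bound_of_continuousOn (s := Icc 0 tf) hic.continuousOn
  have htfm : tf ∈ Icc 0 tf := ⟨htf.le, le_rfl⟩
  have hCs0 : 0 ≤ Cs := (norm_nonneg _).trans (hCs tf htfm)
  have hCi0 : 0 ≤ Ci := (norm_nonneg _).trans (hCi tf htfm)
  have hzero := aux_gronwall (fun t => |P.pii t| + |P.ps t|) tf (β * Ci + (β * Cs + γ))
    ((eVariationOn P.pii (Icc 0 tf)).toReal + |P.pii tf| +
      ((eVariationOn P.ps (Icc 0 tf)).toReal + |P.ps tf|))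
    (by
      intro t ht
      have h1 := P.pi_bv.dist_le ht htfm
      have h2 := P.ps_bv.dist_le ht htfm
      rw [Real.dist_eq] at h1 h2
      have h3 := abs_sub_abs_le_abs_sub (P.pii t) (P.pii tf)
      have h4 := abs_sub_abs_le_abs_sub (P.ps t) (P.ps tf)
      linarith)
    (by
      intro g hg hwg t ht
      have hbd : ∀ r ∈ Ioc t tf, |P.pii r - P.ps r| ≤ g r ∧ |P.pii r| ≤ g r ∧ 0 ≤ g r ∧
          |s r| ≤ Cs ∧ |i r| ≤ Ci := by
        intro r hr
        have hr' : r ∈ Icc 0 tf := ⟨ht.1.trans hr.1.le, hr.2⟩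
        have h1 := hwg r hr'
        have h2 := abs_sub (P.pii r) (P.ps r)
        have h3 := abs_nonneg (P.ps r)
        have h4 := abs_nonneg (P.pii r)
        exact ⟨by linarith, by linarith, by linarith, hCs r hr', hCi r hr'⟩
      have hmt : P.μ (Ioc t tf) = 0 :=
        measure_mono_null (t := Icc (0:ℝ) tf) (fun r hr => ⟨ht.1.trans hr.1.le, hr.2⟩) hμ
      have hS : |P.ps t| ≤ ∫ r in t..tf, (β * Ci) * g r := by
        rw [P.adjoint_s t ht, hp1, zero_add, ← Real.norm_eq_abs]
        refine intervalIntegral.norm_integral_le_of_norm_le ht.2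
          (Filter.Eventually.of_forall ?_) (Continuous.intervalIntegrable (by fun_prop) _ _)
        intro r hr
        obtain ⟨h1, h2, h3, h4, h5⟩ := hbd r hr
        rw [Real.norm_eq_abs, abs_mul, abs_mul]
        calc |P.pii r - P.ps r| * |b r| * |i r| ≤ g r * β * Ci := by
              gcongr; exact hbb r
          _ = _ := by ring
      have hI : |P.pii t| ≤ ∫ r in t..tf, (β * Cs + γ) * g r := by
        rw [P.adjoint_i t ht, hmt, ENNReal.toReal_zero, add_zero, ← Real.norm_eq_abs]
        refine intervalIntegral.norm_integral_le_of_norm_le ht.2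
          (Filter.Eventually.of_forall ?_) (Continuous.intervalIntegrable (by fun_prop) _ _)
        intro r hr
        obtain ⟨h1, h2, h3, h4, h5⟩ := hbd r hr
        rw [Real.norm_eq_abs]
        refine (abs_sub _ _).trans ?_
        rw [abs_mul, abs_mul, abs_mul, abs_of_pos hγ]
        calc |P.pii r - P.ps r| * |b r| * |s r| + γ * |P.pii r| ≤ g r * β * Cs + γ * g r := by
              gcongr; exact hbb r
          _ = _ := by ring
      rw [intervalIntegral.integral_const_mul] at hS hI
      linarith)
  have hmem : ∀ᵐ t ∂(volume.restrict (Icc (0:ℝ) tf)), t ∈ Icc (0:ℝ) tf :=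
    ae_restrict_mem measurableSet_Icc
  filter_upwards [P.minimality, hmem] with t hmin ht
  have h1 := hzero t ht
  have h2 : P.pii t = 0 := abs_eq_zero.1 (by linarith [abs_nonneg (P.pii t), abs_nonneg (P.ps t)])
  have h3 : P.ps t = 0 := abs_eq_zero.1 (by linarith [abs_nonneg (P.pii t), abs_nonneg (P.ps t)])
  have h4 := hmin β ⟨hβ.le, le_rfl⟩
  rw [h2, h3] at h4
  have h5 : P.p0 * lam2 * (β - b t) ≤ 0 := by linarith
  have h6 : 0 < P.p0 * lam2 := mul_pos hp0 hl2
  have h7 : β - b t ≤ 0 := nonpos_of_mul_nonpos_right h5 h6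
  exact le_antisymm (hb.2 t).2 (by linarith)
end
end

section
/- Let λ₁ ≥ 0 and λ₂ > 0. Let (s₀, i₀) ∈ 𝕋 with i₀ > 0 and i₀ ≤ Φ_A(s₀) (i.e. (s₀,i₀) lies in the no-effort zone 𝒜), and let t_f > 0 be such that s^{s₀,i₀,β}(t_f) < γ/β. Then the constant control b ≡ β is admissible for problem 𝒫 from (s₀,i₀) on [0,t_f]; every control b admissible for 𝒫 from (s₀,i₀) on [0,t_f] satisfies J(t_f, b) ≥ λ₁ t_f; and J(t_f, b) = λ₁ t_f if and only if b(t) = β for a.e. t ∈ [0, t_f]. Hence b ≡ β is the unique (up to a.e. equality) optimal control of 𝒫 and the value equals λ₁ t_f. -/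
open MeasureTheory Set Real
open scoped ENNReal

noncomputable section

/-- A control is admissible for problem `𝒫` from `(s₀,i₀)` on `[0,tf]`:
admissible control, trajectory in the viable zone on `[0,tf]`, and strict
no-effort final constraint `s(tf) < γ/β`. -/
def AdmissibleP (γ βs β iM sMs tf s₀ i₀ : ℝ) (b : ℝ → ℝ) : Prop :=
  IsAdmissible βs β b ∧
    ∃ s i, IsTrajectory γ b s₀ i₀ s i ∧
      (∀ t ∈ Set.Icc (0:ℝ) tf, i t ≤ Phi γ βs iM sMs (s t)) ∧
      s tf < γ / β

theorem aux_exp (f g : ℝ → ℝ) (hg : Continuous g) (hf : ∀ t, HasDerivAt f (g t * f t) t) (t : ℝ) :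
    f t = f 0 * Real.exp (∫ r in (0:ℝ)..t, g r) := by
  have hG : ∀ t, HasDerivAt (fun t => ∫ r in (0:ℝ)..t, g r) (g t) t := fun t =>
    (hg.integral_hasStrictDerivAt 0 t).hasDerivAt
  have h : ∀ t, HasDerivAt (fun t => f t * Real.exp (-∫ r in (0:ℝ)..t, g r)) 0 t := by
    intro t
    have := (hf t).mul ((hG t).neg.exp)
    refine this.congr_deriv ?_
    simp only [Pi.neg_apply]
    ring
  have hc := is_const_of_deriv_eq_zero (fun t => (h t).differentiableAt) (fun t => (h t).deriv) t 0
  simp only [intervalIntegral.integral_same, neg_zero, Real.exp_zero, mul_one] at hc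
  rw [← hc, mul_assoc, ← Real.exp_add]
  simp

theorem aux_log (k1 k2 s : ℝ) (h1 : 0 < k1) (h2 : k1 ≤ k2) (hs : k2 ≤ s) :
    k1 + k1 * Real.log (s / k1) ≤ k2 + k2 * Real.log (s / k2) := by
  have h2' : 0 < k2 := by linarith
  have hs' : 0 < s := by linarith
  have e : Real.log (s / k1) = Real.log (s / k2) + Real.log (k2 / k1) := by
    rw [← Real.log_mul (by positivity) (by positivity)]
    congr 1
    field_simp
  have a : Real.log (k2 / k1) ≤ k2 / k1 - 1 := Real.log_le_sub_one_of_pos (by positivity)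
  have b : k1 * Real.log (k2 / k1) ≤ k2 - k1 := by
    calc _ ≤ k1 * (k2 / k1 - 1) := by gcongr
      _ = _ := by field_simp
  have c : 0 ≤ Real.log (s / k2) := Real.log_nonneg (by rw [le_div_iff₀ h2']; linarith)
  rw [e]
  nlinarith [mul_nonneg (sub_nonneg.2 h2) c]

theorem aux_dec (k m s : ℝ) (hk : 0 < k) (hm : k ≤ m) (hs : m ≤ s) :
    - s + k * Real.log (s / k) ≤ - m + k * Real.log (m / k) := by
  have hm' : 0 < m := by linarith
  have hs' : 0 < s := by linarith
  have e : Real.log (s / k) = Real.log (m / k) + Real.log (s / m) := by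
    rw [← Real.log_mul (by positivity) (by positivity)]
    congr 1
    field_simp
  have a : Real.log (s / m) ≤ s / m - 1 := Real.log_le_sub_one_of_pos (by positivity)
  have a0 : 0 ≤ Real.log (s / m) := Real.log_nonneg (by rw [le_div_iff₀ hm']; linarith)
  have b : m * Real.log (s / m) ≤ s - m := by
    calc _ ≤ m * (s / m - 1) := by gcongr
      _ = _ := by field_simp
  rw [e]
  nlinarith

theorem aux_adm (γ βs β iM sM sMs tf : ℝ)
    (hγ : 0 < γ) (hβs : 0 < βs) (hβ : βs < β)
    (hsMs : γ / βs < sMs)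
    (hsMs' : iM - sMs + γ / βs + (γ / βs) * Real.log (βs * sMs / γ) = 0)
    (s₀ i₀ : ℝ) (hT : MemT s₀ i₀) (hi₀ : 0 < i₀)
    (hA : i₀ ≤ Phi γ β iM sM s₀)
    (s i : ℝ → ℝ) (htr : IsTrajectory γ (fun _ => β) s₀ i₀ s i) (t : ℝ) (ht : 0 ≤ t) :
    i t ≤ Phi γ βs iM sMs (s t) := by
  obtain ⟨cs, ci, es, ei⟩ := htr
  have hβ0 : 0 < β := by linarith
  have s0 : s 0 = s₀ := by rw [es]; simp
  have i0 : i 0 = i₀ := by rw [ei]; simp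
  have ds : ∀ t, HasDerivAt s (-(β * i t) * s t) t := by
    intro t
    have hc : Continuous (fun r => β * s r * i r) := by fun_prop
    have := (hc.integral_hasStrictDerivAt 0 t).hasDerivAt.const_sub s₀
    rw [← funext es] at this
    refine this.congr_deriv ?_
    ring
  have di : ∀ t, HasDerivAt i ((β * s t - γ) * i t) t := by
    intro t
    have hc : Continuous (fun r => (β * s r - γ) * i r) := by fun_prop
    have := (hc.integral_hasStrictDerivAt 0 t).hasDerivAt.const_add i₀
    rw [← funext ei] at this
    exact this
  have xs := aux_exp s _ (by fun_prop) ds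
  have xi := aux_exp i _ (by fun_prop) di
  rw [s0] at xs
  rw [i0] at xi
  have ip : ∀ t, 0 < i t := fun t => by rw [xi]; positivity
  have sn : ∀ t, 0 ≤ s t := fun t => by
    rw [xs]; exact mul_nonneg hT.1 (Real.exp_pos _).le
  have hk : γ / β < γ / βs := by gcongr
  have hk1 : 0 < γ / β := by positivity
  by_cases h : s₀ ≤ γ / β
  · have hA' : i₀ ≤ iM := by simpa [Phi, h] using hA
    have sa : Antitone s := antitone_of_deriv_nonpos (fun t => (ds t).differentiableAt) (fun t => by
      rw [(ds t).deriv]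
      have := mul_nonneg (mul_nonneg hβ0.le (ip t).le) (sn t)
      linarith)
    have sle : ∀ t, 0 ≤ t → s t ≤ γ / β := fun t ht => by
      have := sa ht
      linarith
    have ia : AntitoneOn i (Set.Ici 0) := antitoneOn_of_deriv_nonpos (convex_Ici 0) ci.continuousOn
      (fun t _ => (di t).differentiableAt.differentiableWithinAt) (fun t ht' => by
        rw [interior_Ici] at ht'
        rw [(di t).deriv]
        have h1 := sle t (le_of_lt ht')
        rw [le_div_iff₀ hβ0] at h1
        have := ip t
        nlinarith)
    have h2 : i t ≤ i 0 := ia (Set.mem_Ici.2 le_rfl) (Set.mem_Ici.2 ht) ht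
    have h3 : s t ≤ γ / βs := (sle t ht).trans hk.le
    rw [Phi, if_pos h3]
    linarith
  · push Not at h
    have hs₀ : 0 < s₀ := by linarith
    have sp : ∀ t, 0 < s t := fun t => by rw [xs]; positivity
    have hA' : i₀ ≤ iM - s₀ + γ / β + (γ / β) * Real.log (β * s₀ / γ) := by
      rw [Phi, if_neg (not_le.2 h)] at hA
      split_ifs at hA
      · exact hA
      · linarith
    have hV : ∀ t, HasDerivAt (fun t => i t + s t - (γ / β) * Real.log (s t)) 0 t := by
      intro t
      have := ((di t).add (ds t)).sub (((ds t).log (sp t).ne').const_mul (γ / β))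
      refine this.congr_deriv ?_
      have := (sp t).ne'
      field_simp
      ring
    have hc := is_const_of_deriv_eq_zero (fun t => (hV t).differentiableAt)
      (fun t => (hV t).deriv) t 0
    simp only [s0, i0] at hc
    have el : ∀ (b x : ℝ), b * x / γ = x / (γ / b) := fun b x => by
      rw [div_div_eq_mul_div, mul_comm]
    rw [el] at hA' hsMs'
    have hb : i t ≤ iM - s t + γ / β + (γ / β) * Real.log (s t / (γ / β)) := by
      rw [Real.log_div (sp t).ne' hk1.ne']
      rw [Real.log_div hs₀.ne' hk1.ne'] at hA'
      linarith
    rw [Phi]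
    split_ifs with c1 c2
    · have h1 := Real.log_le_sub_one_of_pos (div_pos (sp t) hk1)
      have h2 : γ / β * Real.log (s t / (γ / β)) ≤ s t - γ / β := by
        calc _ ≤ γ / β * (s t / (γ / β) - 1) := by gcongr
          _ = _ := by field_simp
      linarith
    · rw [el]
      have := aux_log _ _ (s t) hk1 hk.le (not_le.1 c1).le
      linarith
    · have := aux_log _ _ (s t) hk1 hk.le (not_le.1 c1).le
      have := aux_dec _ _ (s t) (hk1.trans hk) hsMs.le (not_lt.1 c2)
      linarith

theorem aux_cost (βs β lam1 lam2 tf : ℝ) (b : ℝ → ℝ) (hb : IsAdmissible βs β b) :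
    IntervalIntegrable (fun t => β - b t) volume 0 tf ∧
    cost β lam1 lam2 tf b = lam1 * tf + lam2 * ∫ t in (0:ℝ)..tf, (β - b t) := by
  have hi : IntervalIntegrable (fun t => β - b t) volume 0 tf := by
    apply (intervalIntegrable_const (c := β - βs)).mono_fun
    · exact (measurable_const.sub hb.1).aestronglyMeasurable
    · filter_upwards with t
      have := hb.2 t
      rw [Real.norm_of_nonneg (by linarith [this.2]), Real.norm_of_nonneg (by linarith [this.1, this.2])]
      linarith [this.1]
  refine ⟨hi, ?_⟩
  rw [cost, intervalIntegral.integral_add intervalIntegrable_const (hi.const_mul lam2),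
    intervalIntegral.integral_const_mul]
  simp
  ring

/-- for `(s₀,i₀)` in the no-effort zone (`i₀ ≤ Φ_A(s₀)`,
`i₀ > 0`) and `tf` with `s^{s₀,i₀,β}(tf) < γ/β`: the constant control `β` is
admissible for `𝒫`; every admissible control has cost `≥ λ₁ tf`; and the
cost equals `λ₁ tf` iff `b = β` a.e. on `[0, tf]`. Hence `b ≡ β` is the
unique optimal control and the value is `λ₁ tf`. -/
theorem stmt17 (γ βs β iM sM sMs lam1 lam2 tf : ℝ)
    (hγ : 0 < γ) (hβs : 0 < βs) (hβ : βs < β) (hiM : 0 < iM) (hiM1 : iM < 1)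
    (hsM : γ / β < sM)
    (hsM' : iM - sM + γ / β + (γ / β) * Real.log (β * sM / γ) = 0)
    (hsMs : γ / βs < sMs)
    (hsMs' : iM - sMs + γ / βs + (γ / βs) * Real.log (βs * sMs / γ) = 0)
    (hl1 : 0 ≤ lam1) (hl2 : 0 < lam2) (htf : 0 < tf)
    (s₀ i₀ : ℝ) (hT : MemT s₀ i₀) (hi₀ : 0 < i₀)
    (hA : i₀ ≤ Phi γ β iM sM s₀)
    (sb ib : ℝ → ℝ) (htrajb : IsTrajectory γ (fun _ => β) s₀ i₀ sb ib)
    (hend : sb tf < γ / β) :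
    AdmissibleP γ βs β iM sMs tf s₀ i₀ (fun _ => β) ∧
    (∀ b, AdmissibleP γ βs β iM sMs tf s₀ i₀ b →
      lam1 * tf ≤ cost β lam1 lam2 tf b) ∧
    (∀ b, AdmissibleP γ βs β iM sMs tf s₀ i₀ b →
      (cost β lam1 lam2 tf b = lam1 * tf ↔
        ∀ᵐ t ∂(volume.restrict (Set.Icc (0:ℝ) tf)), b t = β)) := by
  refine ⟨⟨⟨measurable_const, fun _ => ⟨hβ.le, le_rfl⟩⟩, sb, ib, htrajb, fun t ht =>
    aux_adm γ βs β iM sM sMs tf hγ hβs hβ hsMs hsMs' s₀ i₀ hT hi₀ hA sb ib htrajb t ht.1, hend⟩,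
    fun b hb => ?_, fun b hb => ?_⟩
  · obtain ⟨-, e⟩ := aux_cost βs β lam1 lam2 tf b hb.1
    rw [e]
    have : 0 ≤ ∫ t in (0:ℝ)..tf, (β - b t) :=
      intervalIntegral.integral_nonneg htf.le (fun t _ => by linarith [(hb.1.2 t).2])
    have := mul_nonneg hl2.le this
    linarith
  · obtain ⟨hi, e⟩ := aux_cost βs β lam1 lam2 tf b hb.1
    rw [e]
    have h0 : (∫ t in (0:ℝ)..tf, (β - b t)) = 0 ↔
        (fun t => β - b t) =ᵐ[volume.restrict (Set.Ioc 0 tf)] 0 :=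
      intervalIntegral.integral_eq_zero_iff_of_le_of_nonneg_ae htf.le
        (Filter.Eventually.of_forall fun t => by
          have := (hb.1.2 t).2
          simp only [Pi.zero_apply]
          linarith) hi
    rw [add_eq_left, mul_eq_zero, or_iff_right hl2.ne', h0, restrict_Ioc_eq_restrict_Icc]
    refine Filter.eventually_congr (Filter.Eventually.of_forall fun t => ?_)
    simp only [Pi.zero_apply, sub_eq_zero]
    exact eq_comm
end
end
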